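/- arXiv:2507.05776 — 3 statements merged into one kernel-verified Lean document; each statement's English description precedes it below -/
import Mathlib

section
/- Let Ω ⊆ ℝ² be a nonempty bounded convex open set. There exists a constant C > 0, depending only on Ω, with the following property: for every smooth matrix field 𝔸 : Ω → ℝ^{2×2} such that 𝔸(x) is symmetric for every x ∈ Ω, divdiv 𝔸 = 0 on Ω, and ∫_Ω ‖𝔸(x)‖_F² dx < ∞, there exists a smooth vector field θ : Ω → ℝ² with symcurl θ = 𝔸 on Ω and ∫_Ω ‖Dθ(x)‖_F² dx ≤ C ∫_Ω ‖𝔸(x)‖_F² dx, where Dθ denotes the Jacobian matrix of θ. (Smooth-data version of the regularized right-inverse of the symcurl operator, Appendix A.) -/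
open MeasureTheory

noncomputable section

abbrev E2 : Type := EuclideanSpace ℝ (Fin 2)

/-- Partial derivative in direction `i`. -/
def pd (i : Fin 2) (f : E2 → ℝ) (x : E2) : ℝ :=
  fderiv ℝ f x (EuclideanSpace.single i 1)

/-- Row-wise curl of a vector field: the `i`-th row is `(∂₂θᵢ, −∂₁θᵢ)`. -/
def curlVec (θ : E2 → Fin 2 → ℝ) (x : E2) : Matrix (Fin 2) (Fin 2) ℝ :=
  Matrix.of fun i j => if j = 0 then pd 1 (fun y => θ y i) x else -(pd 0 (fun y => θ y i) x)

/-- Symmetric part of the row-wise curl. -/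
def symCurl (θ : E2 → Fin 2 → ℝ) (x : E2) : Matrix (Fin 2) (Fin 2) ℝ :=
  (2⁻¹ : ℝ) • (curlVec θ x + (curlVec θ x).transpose)

/-- Row-wise divergence of a matrix field. -/
def divMat (B : E2 → Matrix (Fin 2) (Fin 2) ℝ) (x : E2) : Fin 2 → ℝ :=
  fun i => pd 0 (fun y => B y i 0) x + pd 1 (fun y => B y i 1) x

/-- Double divergence of a matrix field. -/
def divDiv (B : E2 → Matrix (Fin 2) (Fin 2) ℝ) (x : E2) : ℝ :=
  pd 0 (fun y => divMat B y 0) x + pd 1 (fun y => divMat B y 1) x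

/-- Hessian of a scalar field. -/
def hess (v : E2 → ℝ) (x : E2) : Matrix (Fin 2) (Fin 2) ℝ :=
  Matrix.of fun i j => pd i (fun y => pd j v y) x

/-- Jacobian matrix of a vector field. -/
def jac (θ : E2 → Fin 2 → ℝ) (x : E2) : Matrix (Fin 2) (Fin 2) ℝ :=
  Matrix.of fun i j => pd j (fun y => θ y i) x

/-- Frobenius inner product of 2×2 matrices. -/
def frob (A B : Matrix (Fin 2) (Fin 2) ℝ) : ℝ := ∑ i, ∑ j, A i j * B i j

section Aux

open scoped FourierTransform SchwartzMap ContDiff ENNReal LineDeriv Manifold Topology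

theorem plancherel_aux (G : E2 → ℂ) (h1 : Integrable G) (h2 : MemLp G 2) :
    ((𝓕 (h2.toLp G) : Lp ℂ 2 (volume : Measure E2)) : E2 → ℂ) =ᵐ[volume] 𝓕 G := by
  have hcont : Continuous (𝓕 G) := VectorFourier.fourierIntegral_continuous
    Real.continuous_fourierChar (by exact continuous_inner) h1
  apply ae_eq_of_integral_contDiff_smul_eq
  · exact (Lp.memLp _).locallyIntegrable (by norm_num)
  · exact hcont.locallyIntegrable
  · intro g hg hgs
    have hgs' : HasCompactSupport (fun x => (g x : ℂ)) := hgs.comp_left (g := fun r : ℝ => (r:ℂ)) (by simp)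
    have hg' : ContDiff ℝ ∞ (fun x => (g x : ℂ)) := Complex.ofRealCLM.contDiff.comp hg
    let φ : 𝓢(E2, ℂ) := hgs'.toSchwartzMap hg'
    have hφ : ∀ x, φ x = (g x : ℂ) := fun x => rfl
    have e1 := Lp.fourier_toTemperedDistribution_eq (h2.toLp G)
    have e2 := congrArg (fun T : 𝓢'(E2, ℂ) => T φ) e1
    simp only [Lp.toTemperedDistribution_apply, TemperedDistribution.fourier_apply] at e2
    have e3 : ∫ x, g x • ((𝓕 (h2.toLp G) : Lp ℂ 2 (volume : Measure E2)) : E2 → ℂ) x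
        = ∫ x, φ x • ((𝓕 (h2.toLp G) : Lp ℂ 2 (volume : Measure E2)) : E2 → ℂ) x := by
      refine integral_congr_ae (Filter.Eventually.of_forall fun x => ?_)
      simp [hφ]
    rw [e3, ← e2]
    have e4 := VectorFourier.integral_fourierIntegral_smul_eq_flip (μ := (volume : Measure E2))
      (ν := (volume : Measure E2)) (L := innerₗ E2) (f := φ) (g := G) Real.continuous_fourierChar
      (by exact continuous_inner) φ.integrable h1
    rw [flip_innerₗ] at e4
    calc _ = ∫ x, (𝓕 (φ : E2 → ℂ)) x • G x := by
          refine integral_congr_ae ?_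
          filter_upwards [h2.coeFn_toLp] with x hx
          rw [hx, SchwartzMap.fourier_coe]
      _ = ∫ x, φ x • (𝓕 G) x := e4
      _ = _ := by
          refine integral_congr_ae (Filter.Eventually.of_forall fun x => ?_)
          simp [hφ]

theorem plancherel_lint (G : E2 → ℂ) (h1 : Integrable G) (h2 : MemLp G 2) :
    ∫⁻ y, ‖𝓕⁻ G y‖ₑ ^ 2 = ∫⁻ y, ‖G y‖ₑ ^ 2 := by
  have h := plancherel_aux G h1 h2
  have e : eLpNorm (𝓕 G) 2 volume = eLpNorm G 2 volume := by
    rw [← eLpNorm_congr_ae h, ← eLpNorm_congr_ae h2.coeFn_toLp]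
    have := Lp.norm_fourier_eq (h2.toLp G)
    rw [Lp.norm_def, Lp.norm_def] at this
    exact (ENNReal.toReal_eq_toReal_iff' (Lp.eLpNorm_ne_top _) (Lp.eLpNorm_ne_top _)).1 this
  have key : ∀ f : E2 → ℂ, ∫⁻ y, ‖f y‖ₑ ^ 2 = (eLpNorm f 2 volume) ^ 2 := by
    intro f
    have := eLpNorm_nnreal_pow_eq_lintegral (f := f) (μ := (volume : Measure E2)) (p := 2) (by norm_num)
    simp only [NNReal.coe_ofNat, ENNReal.coe_ofNat] at this
    rw [← ENNReal.rpow_natCast, Nat.cast_ofNat, this]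
    refine lintegral_congr fun y => ?_
    rw [← ENNReal.rpow_natCast, Nat.cast_ofNat]
  calc _ = ∫⁻ y, ‖𝓕 G (-y)‖ₑ ^ 2 := by
        simp_rw [Real.fourierInv_eq_fourier_neg]
    _ = ∫⁻ y, ‖𝓕 G y‖ₑ ^ 2 := lintegral_neg_eq_self (fun y => ‖𝓕 G y‖ₑ ^ 2)
    _ = _ := by rw [key, key, e]

theorem schwartz_decay (f : 𝓢(E2, ℂ)) (k : ℕ) :
    ∃ C : ℝ, 0 < C ∧ ∀ x, ‖f x‖ ≤ C * ((1 + ‖x‖) ^ k)⁻¹ := by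
  let S := (2:ℝ) ^ k * (Finset.Iic (k, 0)).sup (fun m => SchwartzMap.seminorm ℝ m.1 m.2) f
  refine ⟨|S| + 1, by positivity, fun x => ?_⟩
  have h := SchwartzMap.one_add_le_sup_seminorm_apply (𝕜 := ℝ) (m := (k, 0)) (k := k) (n := 0)
    le_rfl le_rfl f x
  simp only [norm_iteratedFDeriv_zero] at h
  have h2 : (1 + ‖x‖) ^ k * ‖f x‖ ≤ |S| + 1 := by
    refine h.trans ?_
    have := le_abs_self S
    simp only [S] at this ⊢
    linarith
  have hp : 0 < (1 + ‖x‖) ^ k := by positivity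
  rw [← div_eq_mul_inv, le_div_iff₀ hp]
  linarith

/-- The Fourier side of the averaged operator. -/
def Gfun (a b : 𝓢(E2, ℂ)) (η : E2) : ℂ :=
  ∫ r in Set.Ioc (0:ℝ) 1, a ((1 + r) • η) * b (-(r • η))

theorem Gker_integrable (a b : 𝓢(E2, ℂ)) :
    Integrable (fun p : E2 × ℝ => a ((1 + p.2) • p.1) * b (-(p.2 • p.1)))
      ((volume : Measure E2).prod (volume.restrict (Set.Ioc (0:ℝ) 1))) := by
  obtain ⟨Ca, hCa0, hCa⟩ := schwartz_decay a 3
  obtain ⟨Cb, hCb0, hCb⟩ := schwartz_decay b 0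
  have h3 : Integrable (fun x : E2 => Ca * ((1 + ‖x‖) ^ 3)⁻¹ * Cb) := by
    have := integrable_one_add_norm (E := E2) (μ := volume) (r := 3) (by simp; norm_num)
    refine ((this.const_mul Ca).mul_const Cb).congr (Filter.Eventually.of_forall fun x => ?_)
    simp only
    rw [Real.rpow_neg (by positivity)]
    norm_cast
  have hintg : Integrable (fun p : E2 × ℝ => (Ca * ((1 + ‖p.1‖) ^ 3)⁻¹ * Cb) * (1:ℝ))
      ((volume : Measure E2).prod (volume.restrict (Set.Ioc (0:ℝ) 1))) :=
    h3.mul_prod (integrable_const (1:ℝ))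
  refine hintg.mono' ?_ ?_
  · refine Continuous.aestronglyMeasurable ?_
    exact (a.continuous.comp (by fun_prop)).mul (b.continuous.comp (by fun_prop))
  · have : (volume : Measure E2).prod (volume.restrict (Set.Ioc (0:ℝ) 1))
        = ((volume : Measure E2).prod volume).restrict (Set.univ ×ˢ Set.Ioc (0:ℝ) 1) := by
      rw [← Measure.prod_restrict, Measure.restrict_univ]
    rw [this]
    refine ae_restrict_of_forall_mem (MeasurableSet.univ.prod measurableSet_Ioc) ?_
    rintro ⟨x, r⟩ ⟨-, hr⟩
    simp only [norm_mul, mul_one]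
    have hr0 := hr.1
    simp only at hr0
    have h1 : ‖x‖ ≤ ‖(1 + r) • x‖ := by
      rw [norm_smul, Real.norm_of_nonneg (by linarith)]
      nlinarith [norm_nonneg x]
    have h2 := hCb (-(r • x))
    simp only [pow_zero, inv_one, mul_one] at h2
    refine mul_le_mul ((hCa _).trans ?_) h2 (norm_nonneg _) (by positivity)
    gcongr

theorem Gfun_integrable (a b : 𝓢(E2, ℂ)) : Integrable (Gfun a b) :=
  (Gker_integrable a b).integral_prod_left

theorem inner_fourier (H g : 𝓢(E2, ℂ)) (y : E2) (r : ℝ) (hr : 0 < r) :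
    ∫ η : E2, Complex.exp (↑(2 * Real.pi * inner ℝ η y) * Complex.I) •
        ((𝓕 H) ((1 + r) • η) * (𝓕 g) (-(r • η)))
      = ∫ z, g z * ((((1 + r) ^ 2)⁻¹ : ℝ) • H ((1 + r)⁻¹ • (y + r • z))) := by
  have hr1 : (1 + r) ≠ 0 := by positivity
  have e1 : ∀ η : E2, (𝓕 g) (-(r • η)) =
      ∫ z, Complex.exp (↑(2 * Real.pi * inner ℝ η (r • z)) * Complex.I) • g z := by
    intro η
    rw [SchwartzMap.fourier_coe, Real.fourier_eq']
    refine integral_congr_ae (Filter.Eventually.of_forall fun z => ?_)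
    simp only [inner_neg_right, inner_smul_right, real_inner_comm z η]
    congr 3
    push_cast; ring
  have hI : Integrable (fun p : E2 × E2 =>
      Complex.exp (↑(2 * Real.pi * inner ℝ p.1 (y + r • p.2)) * Complex.I) *
        ((𝓕 H) ((1 + r) • p.1) * g p.2)) ((volume : Measure E2).prod volume) := by
    have h0 : Integrable (fun η : E2 => (𝓕 H) ((1 + r) • η)) :=
      (integrable_comp_smul_iff volume ((𝓕 H : 𝓢(E2, ℂ)) : E2 → ℂ) hr1).2 (𝓕 H : 𝓢(E2, ℂ)).integrable
    refine (h0.mul_prod g.integrable).bdd_mul (c := 1) ?_ ?_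
    · refine Continuous.aestronglyMeasurable ?_
      fun_prop
    · refine Filter.Eventually.of_forall fun p => ?_
      rw [Complex.norm_exp_ofReal_mul_I]
  calc _ = ∫ η : E2, ∫ z, Complex.exp (↑(2 * Real.pi * inner ℝ η (y + r • z)) * Complex.I) *
        ((𝓕 H) ((1 + r) • η) * g z) := by
        refine integral_congr_ae (Filter.Eventually.of_forall fun η => ?_)
        simp only
        rw [e1, smul_eq_mul, ← mul_assoc, ← integral_const_mul]
        refine integral_congr_ae (Filter.Eventually.of_forall fun z => ?_)
        simp only [inner_add_right, smul_eq_mul]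
        rw [show ((2 * Real.pi * (inner ℝ η y + inner ℝ η (r • z)) : ℝ) : ℂ) * Complex.I
          = ((2 * Real.pi * (inner ℝ η y) : ℝ) : ℂ) * Complex.I +
            ((2 * Real.pi * inner ℝ η (r • z) : ℝ) : ℂ) * Complex.I by push_cast; ring,
          Complex.exp_add]
        ring
    _ = ∫ z, ∫ η : E2, Complex.exp (↑(2 * Real.pi * inner ℝ η (y + r • z)) * Complex.I) *
        ((𝓕 H) ((1 + r) • η) * g z) := integral_integral_swap hI
    _ = _ := by
        refine integral_congr_ae (Filter.Eventually.of_forall fun z => ?_)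
        simp only
        have e2 : H ((1 + r)⁻¹ • (y + r • z)) = 𝓕⁻ ((𝓕 H : 𝓢(E2, ℂ)) : E2 → ℂ) ((1 + r)⁻¹ • (y + r • z)) := by
          rw [← SchwartzMap.fourierInv_coe, FourierTransform.fourierInv_fourier_eq]
        have e3 := Measure.integral_comp_smul (volume : Measure E2)
          (fun ξ : E2 => Complex.exp (↑(2 * Real.pi *
            inner ℝ ξ ((1 + r)⁻¹ • (y + r • z))) * Complex.I) • (𝓕 H) ξ) (1 + r)
        rw [finrank_euclideanSpace_fin, abs_of_pos (by positivity)] at e3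
        rw [e2, Real.fourierInv_eq', ← e3, ← integral_const_mul]
        refine integral_congr_ae (Filter.Eventually.of_forall fun η => ?_)
        simp only [inner_smul_left, inner_smul_right, smul_eq_mul]
        rw [show (starRingEnd ℝ) (1 + r) = 1 + r from rfl, inv_mul_cancel_left₀ hr1]
        ring

theorem Gfun_fourierInv (H g : 𝓢(E2, ℂ)) (y : E2) :
    𝓕⁻ (Gfun (𝓕 H) (𝓕 g)) y = ∫ r in Set.Ioc (0:ℝ) 1,
      ∫ z, g z * ((((1 + r) ^ 2)⁻¹ : ℝ) • H ((1 + r)⁻¹ • (y + r • z))) := by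
  rw [Real.fourierInv_eq']
  unfold Gfun
  have hI : Integrable (fun p : E2 × ℝ =>
      Complex.exp (↑(2 * Real.pi * inner ℝ p.1 y) * Complex.I) *
        ((𝓕 H) ((1 + p.2) • p.1) * (𝓕 g) (-(p.2 • p.1))))
        ((volume : Measure E2).prod (volume.restrict (Set.Ioc (0:ℝ) 1))) := by
    refine (Gker_integrable (𝓕 H) (𝓕 g)).bdd_mul (c := 1) ?_ ?_
    · refine Continuous.aestronglyMeasurable ?_
      fun_prop
    · refine Filter.Eventually.of_forall fun p => ?_
      rw [Complex.norm_exp_ofReal_mul_I]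
  calc _ = ∫ η : E2, ∫ r in Set.Ioc (0:ℝ) 1,
        Complex.exp (↑(2 * Real.pi * inner ℝ η y) * Complex.I) *
        ((𝓕 H) ((1 + r) • η) * (𝓕 g) (-(r • η))) := by
        refine integral_congr_ae (Filter.Eventually.of_forall fun η => ?_)
        simp only
        rw [smul_eq_mul, ← integral_const_mul]
    _ = ∫ r in Set.Ioc (0:ℝ) 1, ∫ η : E2,
        Complex.exp (↑(2 * Real.pi * inner ℝ η y) * Complex.I) *
        ((𝓕 H) ((1 + r) • η) * (𝓕 g) (-(r • η))) := integral_integral_swap hI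
    _ = _ := by
        refine setIntegral_congr_fun measurableSet_Ioc fun r hr => ?_
        rw [← inner_fourier H g y r hr.1]
        rfl

theorem lint_cs {α : Type*} [MeasurableSpace α] (μ : Measure α) (f g : α → ℝ≥0∞)
    (hf : AEMeasurable f μ) (hg : AEMeasurable g μ) :
    (∫⁻ x, f x * g x ∂μ) ^ 2 ≤ (∫⁻ x, f x ^ 2 ∂μ) * (∫⁻ x, g x ^ 2 ∂μ) := by
  have h := ENNReal.lintegral_mul_le_Lp_mul_Lq μ Real.HolderConjugate.two_two hf hg
  simp only [Pi.mul_apply, ENNReal.rpow_ofNat] at h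
  have h2 := pow_le_pow_left' h 2
  refine h2.trans (le_of_eq ?_)
  rw [mul_pow]
  congr 1 <;>
  · rw [← ENNReal.rpow_natCast, ← ENNReal.rpow_mul]; norm_num

/-- The kernel weight. -/
def wt (t r : ℝ) : ℝ := t * ((1 + r * t) ^ 2)⁻¹

theorem wt_nonneg {t r : ℝ} (ht : 0 ≤ t) : 0 ≤ wt t r := by unfold wt; positivity

theorem wt_cont_aux (t : ℝ) (ht : 0 ≤ t) : ∫⁻ r in Set.Ioc (0:ℝ) 1, ENNReal.ofReal (wt t r) ≤ 1 := by
  have hd : ∀ r ∈ Set.uIcc (0:ℝ) 1, HasDerivAt (fun r : ℝ => -(1 + r * t)⁻¹) (wt t r) r := by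
    intro r hr
    rw [Set.uIcc_of_le zero_le_one] at hr
    have hp : 1 + r * t ≠ 0 := by have := hr.1; positivity
    have h1 : HasDerivAt (fun r : ℝ => 1 + r * t) t r := by
      simpa using ((hasDerivAt_id r).mul_const t).const_add 1
    refine (h1.inv hp).neg.congr_deriv ?_
    unfold wt
    field_simp
  have hc : ContinuousOn (wt t) (Set.uIcc (0:ℝ) 1) := by
    unfold wt
    refine continuousOn_const.mul (ContinuousOn.inv₀ (by fun_prop) ?_)
    intro r hr
    rw [Set.uIcc_of_le zero_le_one] at hr
    have := hr.1
    positivity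
  have hi : IntervalIntegrable (wt t) volume 0 1 := hc.intervalIntegrable
  have e := intervalIntegral.integral_eq_sub_of_hasDerivAt hd hi
  rw [intervalIntegral.integral_of_le zero_le_one] at e
  rw [← ofReal_integral_eq_lintegral_ofReal
    ((intervalIntegrable_iff_integrableOn_Ioc_of_le zero_le_one).1 hi)
    (Filter.Eventually.of_forall fun r => wt_nonneg ht), e]
  rw [← ENNReal.ofReal_one]
  apply ENNReal.ofReal_le_ofReal
  have : 0 ≤ (1 + 1 * t)⁻¹ := by positivity
  simp only [zero_mul, add_zero, inv_one]
  linarith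

theorem wt_scale {t r : ℝ} (ht : 0 ≤ t) (hr : 0 < r) (hr1 : r ≤ 1) :
    wt t r ≤ 4 * wt ((1 + r) * t) r := by
  unfold wt
  have h1 : 0 < 1 + r * t := by positivity
  have h2 : 0 < 1 + r * ((1 + r) * t) := by positivity
  rw [← div_eq_mul_inv, ← div_eq_mul_inv, ← mul_div_assoc, div_le_div_iff₀ (by positivity) (by positivity)]
  have h3 : 1 + r * ((1 + r) * t) ≤ 2 * (1 + r * t) := by
    have : 0 ≤ r * t := by positivity
    nlinarith
  have h4 : (1 + r * ((1 + r) * t)) ^ 2 ≤ 4 * (1 + r * t) ^ 2 := by nlinarith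
  have h5 : t ≤ (1 + r) * t := by nlinarith
  calc t * (1 + r * ((1 + r) * t)) ^ 2 ≤ ((1 + r) * t) * (4 * (1 + r * t) ^ 2) := by gcongr
    _ = _ := by ring

theorem lint_comp_smul (f : E2 → ℝ≥0∞) (hf : Measurable f) (R : ℝ) (hR : 1 ≤ R) :
    ∫⁻ x, f (R • x) ≤ ∫⁻ x, f x := by
  have hR0 : R ≠ 0 := by positivity
  rw [← lintegral_map (f := f) hf (measurable_const_smul R), Measure.map_addHaar_smul _ hR0,
    lintegral_smul_measure]
  refine (mul_le_mul_left (ENNReal.ofReal_le_one.2 ?_) _).trans (one_mul _).le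
  rw [finrank_euclideanSpace_fin, abs_of_nonneg (by positivity)]
  exact inv_le_one_of_one_le₀ (one_le_pow₀ hR)

theorem wt_meas : Measurable (fun p : E2 × ℝ => ENNReal.ofReal (wt ‖p.1‖ p.2)) := by
  unfold wt; fun_prop

theorem tonelli_wt (Φ : E2 → ℝ≥0∞) (hΦ : Measurable Φ) :
    ∫⁻ η : E2, ∫⁻ r in Set.Ioc (0:ℝ) 1, ENNReal.ofReal (wt ‖η‖ r) * Φ ((1 + r) • η)
      ≤ 4 * ∫⁻ η, Φ η := by
  calc _ = ∫⁻ r in Set.Ioc (0:ℝ) 1, ∫⁻ η : E2, ENNReal.ofReal (wt ‖η‖ r) * Φ ((1 + r) • η) := by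
        rw [lintegral_lintegral_swap]
        refine Measurable.aemeasurable ?_
        exact wt_meas.mul (hΦ.comp (by fun_prop))
    _ ≤ ∫⁻ r in Set.Ioc (0:ℝ) 1, ∫⁻ η : E2, 4 * (ENNReal.ofReal (wt ‖η‖ r) * Φ η) := by
        refine setLIntegral_mono_ae' measurableSet_Ioc (Filter.Eventually.of_forall fun r hr => ?_)
        refine le_trans (lintegral_mono (fun η => ?_)) (lint_comp_smul
          (fun η : E2 => 4 * (ENNReal.ofReal (wt ‖η‖ r) * Φ η)) ?_ (1 + r) (by linarith [hr.1]))
        · simp only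
          rw [← mul_assoc]
          refine mul_le_mul_left ?_ _
          rw [show (4:ℝ≥0∞) = ENNReal.ofReal 4 by simp, ← ENNReal.ofReal_mul (by norm_num)]
          apply ENNReal.ofReal_le_ofReal
          have := wt_scale (norm_nonneg η) hr.1 hr.2
          rwa [norm_smul, Real.norm_of_nonneg (by linarith [hr.1])]
        · exact ((wt_meas.comp (measurable_id.prodMk measurable_const)).mul hΦ).const_mul _
    _ = ∫⁻ η : E2, ∫⁻ r in Set.Ioc (0:ℝ) 1, 4 * (ENNReal.ofReal (wt ‖η‖ r) * Φ η) := by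
        rw [lintegral_lintegral_swap]
        refine Measurable.aemeasurable ?_
        exact ((wt_meas.comp measurable_swap).mul (hΦ.comp measurable_snd)).const_mul _
    _ ≤ ∫⁻ η : E2, 4 * Φ η := by
        refine lintegral_mono fun η => ?_
        have hm1 : Measurable (fun r : ℝ => ENNReal.ofReal (wt ‖η‖ r)) := by
          unfold wt; fun_prop
        rw [lintegral_const_mul' _ _ (by norm_num), lintegral_mul_const _ hm1]
        refine mul_le_mul_right ?_ _
        exact (mul_le_mul_left (wt_cont_aux ‖η‖ (norm_nonneg _)) _).trans (one_mul _).le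
    _ = _ := by rw [lintegral_const_mul' _ _ (by norm_num)]

theorem Gfun_bound (g : 𝓢(E2, ℂ)) : ∃ C : ℝ≥0∞, C ≠ ⊤ ∧ ∀ (F : 𝓢(E2, ℂ)) (m : E2), ‖m‖ = 1 →
    ∫⁻ η, ‖Gfun (𝓕 (∂_{m} F)) (𝓕 g) η‖ₑ ^ 2 ≤ C * ∫⁻ x, ‖F x‖ₑ ^ 2 := by
  obtain ⟨C, hC0, hC⟩ := schwartz_decay (𝓕 g) 2
  let K : ℝ≥0∞ := ENNReal.ofReal (4 * Real.pi * C)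
  refine ⟨K ^ 2 * 4, by finiteness, fun F m hm => ?_⟩
  let Φ : E2 → ℝ≥0∞ := fun x => ‖(𝓕 F : 𝓢(E2, ℂ)) x‖ₑ
  have hΦ : Measurable Φ := (𝓕 F : 𝓢(E2, ℂ)).continuous.measurable.enorm
  have ha : ∀ ξ, ‖(𝓕 (∂_{m} F) : 𝓢(E2, ℂ)) ξ‖ ≤ 2 * Real.pi * ‖ξ‖ * ‖(𝓕 F : 𝓢(E2, ℂ)) ξ‖ := by
    intro ξ
    have htg : (inner ℝ · m : E2 → ℝ).HasTemperateGrowth := ((innerSL ℝ).flip m).hasTemperateGrowth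
    rw [SchwartzMap.fourier_lineDerivOp_eq, _root_.smul_apply,
      SchwartzMap.smulLeftCLM_apply_apply htg]
    rw [norm_smul, norm_smul]
    have h1 : ‖(2 * Real.pi * Complex.I : ℂ)‖ = 2 * Real.pi := by
      simp [abs_of_pos Real.pi_pos]
    rw [h1, ← mul_assoc]
    have := norm_inner_le_norm (𝕜 := ℝ) ξ m
    rw [hm, mul_one] at this
    gcongr
  have hpt : ∀ η, ‖Gfun (𝓕 (∂_{m} F)) (𝓕 g) η‖ₑ ≤
      K * ∫⁻ r in Set.Ioc (0:ℝ) 1, ENNReal.ofReal (wt ‖η‖ r) * Φ ((1 + r) • η) := by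
    intro η
    unfold Gfun
    refine (enorm_integral_le_lintegral_enorm _).trans ?_
    rw [← lintegral_const_mul' _ _ (by finiteness)]
    refine setLIntegral_mono_ae' measurableSet_Ioc (Filter.Eventually.of_forall fun r hr => ?_)
    have hr0 := hr.1
    have hr1 := hr.2
    simp only [Φ, K]
    rw [← ofReal_norm, ← ofReal_norm, ← ENNReal.ofReal_mul (wt_nonneg (norm_nonneg _)),
      ← ENNReal.ofReal_mul (by positivity)]
    apply ENNReal.ofReal_le_ofReal
    rw [norm_mul]
    have h1 := ha ((1 + r) • η)
    have h2 := hC (-(r • η))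
    rw [norm_neg, norm_smul, Real.norm_of_nonneg hr0.le] at h2
    rw [norm_smul (1 + r), Real.norm_of_nonneg (by linarith)] at h1
    calc _ ≤ (2 * Real.pi * ((1 + r) * ‖η‖) * ‖(𝓕 F : 𝓢(E2, ℂ)) ((1 + r) • η)‖) *
          (C * ((1 + r * ‖η‖) ^ 2)⁻¹) := by gcongr
      _ ≤ (2 * Real.pi * (2 * ‖η‖) * ‖(𝓕 F : 𝓢(E2, ℂ)) ((1 + r) • η)‖) *
          (C * ((1 + r * ‖η‖) ^ 2)⁻¹) := by gcongr; linarith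
      _ = _ := by unfold wt; ring
  have hsq : ∀ η, ‖Gfun (𝓕 (∂_{m} F)) (𝓕 g) η‖ₑ ^ 2 ≤
      K ^ 2 * ∫⁻ r in Set.Ioc (0:ℝ) 1, ENNReal.ofReal (wt ‖η‖ r) * Φ ((1 + r) • η) ^ 2 := by
    intro η
    refine (pow_le_pow_left' (hpt η) 2).trans ?_
    rw [mul_pow]
    refine mul_le_mul_right ?_ _
    have hs : ∀ r, ENNReal.ofReal (Real.sqrt (wt ‖η‖ r)) ^ 2 = ENNReal.ofReal (wt ‖η‖ r) := by
      intro r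
      rw [← ENNReal.ofReal_pow (Real.sqrt_nonneg _), Real.sq_sqrt (wt_nonneg (norm_nonneg _))]
    have hm1 : Measurable (fun r : ℝ => ENNReal.ofReal (Real.sqrt (wt ‖η‖ r))) := by
      unfold wt; fun_prop
    have hm2 : Measurable (fun r : ℝ => Φ ((1 + r) • η)) := hΦ.comp (by fun_prop)
    have := lint_cs (volume.restrict (Set.Ioc (0:ℝ) 1))
      (fun r => ENNReal.ofReal (Real.sqrt (wt ‖η‖ r)))
      (fun r => ENNReal.ofReal (Real.sqrt (wt ‖η‖ r)) * Φ ((1 + r) • η))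
      hm1.aemeasurable (hm1.mul hm2).aemeasurable
    simp only [← mul_assoc, ← sq, mul_pow, hs] at this
    refine this.trans ?_
    exact (mul_le_mul_left (wt_cont_aux ‖η‖ (norm_nonneg _)) _).trans (one_mul _).le
  have hpl : ∫⁻ x, Φ x ^ 2 = ∫⁻ x, ‖F x‖ₑ ^ 2 := by
    have := plancherel_lint (𝓕 F : 𝓢(E2, ℂ)) (𝓕 F : 𝓢(E2, ℂ)).integrable ((𝓕 F : 𝓢(E2, ℂ)).memLp 2)
    rw [← SchwartzMap.fourierInv_coe, FourierTransform.fourierInv_fourier_eq] at this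
    exact this.symm
  calc _ ≤ ∫⁻ η, K ^ 2 * ∫⁻ r in Set.Ioc (0:ℝ) 1, ENNReal.ofReal (wt ‖η‖ r) * Φ ((1 + r) • η) ^ 2 :=
        lintegral_mono hsq
    _ = K ^ 2 * ∫⁻ η, ∫⁻ r in Set.Ioc (0:ℝ) 1, ENNReal.ofReal (wt ‖η‖ r) * Φ ((1 + r) • η) ^ 2 :=
        lintegral_const_mul' _ _ (by finiteness)
    _ ≤ K ^ 2 * (4 * ∫⁻ x, Φ x ^ 2) :=
        mul_le_mul_right (tonelli_wt (fun x => Φ x ^ 2) (hΦ.pow_const 2)) _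
    _ = _ := by rw [hpl, mul_assoc]

theorem U_bound (g : 𝓢(E2, ℂ)) : ∃ C : ℝ≥0∞, C ≠ ⊤ ∧ ∀ (F : 𝓢(E2, ℂ)) (m : E2), ‖m‖ = 1 →
    ∫⁻ y, ‖∫ r in Set.Ioc (0:ℝ) 1,
      ∫ z, g z * ((((1 + r) ^ 2)⁻¹ : ℝ) • (∂_{m} F) ((1 + r)⁻¹ • (y + r • z)))‖ₑ ^ 2
        ≤ C * ∫⁻ x, ‖F x‖ₑ ^ 2 := by
  obtain ⟨C, hC, h⟩ := Gfun_bound g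
  refine ⟨C, hC, fun F m hm => ?_⟩
  have h2 := h F m hm
  have hI := Gfun_integrable (𝓕 (∂_{m} F)) (𝓕 g)
  have hF : ∫⁻ x, ‖F x‖ₑ ^ 2 ≠ ⊤ := by
    have := (F.memLp 2 volume).2
    have h3 := lintegral_rpow_enorm_lt_top_of_eLpNorm_lt_top (p := 2) (by norm_num) (by norm_num) this
    simpa using h3.ne
  have hM : MemLp (Gfun (𝓕 (∂_{m} F)) (𝓕 g)) 2 := by
    refine ⟨hI.1, ?_⟩
    rw [eLpNorm_lt_top_iff_lintegral_rpow_enorm_lt_top (by norm_num) (by norm_num)]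
    simpa using h2.trans_lt (ENNReal.mul_lt_top hC.lt_top hF.lt_top)
  have h3 := plancherel_lint _ hI hM
  simp only [Gfun_fourierInv] at h3
  rw [h3]
  exact h2

/-- Averaged line integral. -/
def Sop (a b : ℝ) (κ : ℝ → ℝ) (c : E2 → ℝ → E2) (ψ h : E2 → ℝ) : ℝ :=
  ∫ r in Set.Ioc a b, ∫ z, ψ z * (κ r * h (c z r))

theorem pd_cont (j : Fin 2) (f : E2 → ℝ) (hf : ContDiff ℝ ∞ f) : Continuous (pd j f) := by
  have := hf.continuous_fderiv (by simp)
  unfold pd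
  fun_prop

theorem pd_bdd (j : Fin 2) (f : E2 → ℝ) (hf : ContDiff ℝ ∞ f) (hs : HasCompactSupport f) :
    ∃ M : ℝ, ∀ x, ‖pd j f x‖ ≤ M := by
  have h1 : HasCompactSupport (pd j f) := by
    have := hs.fderiv (𝕜 := ℝ)
    refine this.comp_left (g := fun L : E2 →L[ℝ] ℝ => L (EuclideanSpace.single j 1)) (by simp)
  exact h1.exists_bound_of_continuous (pd_cont j f hf)

theorem ker_integrable (a b : ℝ) (κ : ℝ → ℝ) (hκ : Measurable κ)
    (hκ1 : ∀ r ∈ Set.Ioc a b, |κ r| ≤ 1) (c : E2 → ℝ → E2)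
    (hc : Measurable (fun p : E2 × ℝ => c p.1 p.2)) (ψ h : E2 → ℝ) (hψ : Integrable ψ)
    (hh : Continuous h) (M : ℝ) (hM : ∀ x, ‖h x‖ ≤ M) :
    Integrable (fun p : E2 × ℝ => ψ p.1 * (κ p.2 * h (c p.1 p.2)))
      ((volume : Measure E2).prod (volume.restrict (Set.Ioc a b))) := by
  have h1 : Integrable (fun p : E2 × ℝ => ψ p.1 * (1:ℝ))
      ((volume : Measure E2).prod (volume.restrict (Set.Ioc a b))) :=
    hψ.mul_prod (integrable_const (1:ℝ))
  simp only [mul_one] at h1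
  refine h1.mul_bdd (c := M) ?_ ?_
  · refine Measurable.aestronglyMeasurable ?_
    exact (hκ.comp measurable_snd).mul (hh.measurable.comp hc)
  · have : (volume : Measure E2).prod (volume.restrict (Set.Ioc a b))
        = ((volume : Measure E2).prod volume).restrict (Set.univ ×ˢ Set.Ioc a b) := by
      rw [← Measure.prod_restrict, Measure.restrict_univ]
    rw [this]
    refine ae_restrict_of_forall_mem (MeasurableSet.univ.prod measurableSet_Ioc) ?_
    rintro ⟨x, r⟩ ⟨-, hr⟩
    rw [norm_mul]
    calc _ ≤ 1 * ‖h (c x r)‖ := by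
          gcongr
          exact hκ1 r hr
      _ ≤ M := by rw [one_mul]; exact hM _

theorem fderiv_expand (f : E2 → ℝ) (x v : E2) : fderiv ℝ f x v = ∑ k, v k * pd k f x := by
  have : v = ∑ k, v k • EuclideanSpace.single k (1:ℝ) := by
    ext i
    fin_cases i <;> simp
  conv_lhs => rw [this]
  simp [pd]

theorem path_lemma (y : E2) (a b : ℝ) (hab : a ≤ b) (κ : ℝ → ℝ) (hκ : Measurable κ)
    (hκc : ContinuousOn κ (Set.Icc a b))
    (hκ1 : ∀ r ∈ Set.Ioc a b, |κ r| ≤ 1) (c : E2 → ℝ → E2)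
    (hc : Measurable (fun p : E2 × ℝ => c p.1 p.2)) (om : E2 → ℝ) (hom : Integrable om)
    (homk : ∀ k : Fin 2, Integrable (fun z : E2 => z k * om z)) (K : Set E2)
    (hcd : ∀ z, om z ≠ 0 → ∀ r ∈ Set.Icc a b, c z r ∈ K ∧ HasDerivAt (c z) (κ r • (z - y)) r)
    (ρ : E2 → ℝ) (F : Fin 2 → Fin 2 → E2 → ℝ)
    (hρ : ∀ x ∈ K, DifferentiableAt ℝ ρ x)
    (hF : ∀ k j, ContDiff ℝ ∞ (F k j)) (hFs : ∀ k j, HasCompactSupport (F k j))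
    (hρF : ∀ x ∈ K, ∀ k, pd k ρ x = ∑ j, pd j (F k j) x) :
    Integrable (fun z => om z * (ρ (c z b) - ρ (c z a))) ∧
    ∫ z, om z * (ρ (c z b) - ρ (c z a)) =
      ∑ k, ∑ j, (Sop a b κ c (fun z => z k * om z) (pd j (F k j))
        - y k * Sop a b κ c om (pd j (F k j))) := by
  let Q : E2 × ℝ → ℝ := fun p => ∑ k, ∑ j,
    ((p.1 k * om p.1) * (κ p.2 * pd j (F k j) (c p.1 p.2))
      - y k * (om p.1 * (κ p.2 * pd j (F k j) (c p.1 p.2))))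
  have hI1 : ∀ k j, Integrable (fun p : E2 × ℝ => (p.1 k * om p.1) * (κ p.2 * pd j (F k j) (c p.1 p.2)))
      ((volume : Measure E2).prod (volume.restrict (Set.Ioc a b))) := by
    intro k j
    obtain ⟨M, hM⟩ := pd_bdd j (F k j) (hF k j) (hFs k j)
    exact ker_integrable a b κ hκ hκ1 c hc (fun z => z k * om z) _ (homk k) (pd_cont j _ (hF k j)) M hM
  have hI2 : ∀ k j, Integrable (fun p : E2 × ℝ => om p.1 * (κ p.2 * pd j (F k j) (c p.1 p.2)))
      ((volume : Measure E2).prod (volume.restrict (Set.Ioc a b))) := by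
    intro k j
    obtain ⟨M, hM⟩ := pd_bdd j (F k j) (hF k j) (hFs k j)
    exact ker_integrable a b κ hκ hκ1 c hc om _ hom (pd_cont j _ (hF k j)) M hM
  have hIt : ∀ k j, Integrable (fun p : E2 × ℝ =>
      (p.1 k * om p.1) * (κ p.2 * pd j (F k j) (c p.1 p.2))
      - y k * (om p.1 * (κ p.2 * pd j (F k j) (c p.1 p.2))))
      ((volume : Measure E2).prod (volume.restrict (Set.Ioc a b))) :=
    fun k j => (hI1 k j).sub ((hI2 k j).const_mul _)
  have hQ : Integrable Q ((volume : Measure E2).prod (volume.restrict (Set.Ioc a b))) :=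
    integrable_finsetSum _ fun k _ => integrable_finsetSum _ fun j _ => hIt k j
  have hpt : ∀ z, om z * (ρ (c z b) - ρ (c z a)) = ∫ r in Set.Ioc a b, Q (z, r) := by
    intro z
    by_cases hz : om z = 0
    · simp [Q, hz]
    have hcz := hcd z hz
    have hd : ∀ r ∈ Set.uIcc a b, HasDerivAt (fun r => ρ (c z r))
        (κ r * ∑ k, (z k - y k) * ∑ j, pd j (F k j) (c z r)) r := by
      intro r hr
      rw [Set.uIcc_of_le hab] at hr
      have h1 := (hρ _ (hcz r hr).1).hasFDerivAt.comp_hasDerivAt r (hcz r hr).2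
      refine h1.congr_deriv ?_
      rw [map_smul, smul_eq_mul, fderiv_expand]
      congr 1
      refine Finset.sum_congr rfl fun k _ => ?_
      rw [hρF _ (hcz r hr).1 k]
      simp
    have hcc : ContinuousOn (c z) (Set.Icc a b) := fun r hr =>
      (hcz r hr).2.continuousAt.continuousWithinAt
    have hcont : ContinuousOn (fun r => κ r * ∑ k, (z k - y k) * ∑ j, pd j (F k j) (c z r))
        (Set.uIcc a b) := by
      rw [Set.uIcc_of_le hab]
      refine hκc.mul (continuousOn_finsetSum _ fun k _ => continuousOn_const.mul
        (continuousOn_finsetSum _ fun j _ => (pd_cont j _ (hF k j)).comp_continuousOn hcc))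
    have e := intervalIntegral.integral_eq_sub_of_hasDerivAt hd hcont.intervalIntegrable
    rw [← e, intervalIntegral.integral_of_le hab, ← integral_const_mul]
    refine integral_congr_ae (Filter.Eventually.of_forall fun r => ?_)
    simp only [Q, Fin.sum_univ_two]
    ring
  have hfun : (fun z => om z * (ρ (c z b) - ρ (c z a))) = fun z => ∫ r in Set.Ioc a b, Q (z, r) :=
    funext hpt
  rw [hfun]
  refine ⟨hQ.integral_prod_left, ?_⟩
  rw [← integral_prod _ hQ]
  simp only [Q]
  rw [integral_finsetSum _ fun k _ => integrable_finsetSum _ fun j _ => hIt k j]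
  refine Finset.sum_congr rfl fun k _ => ?_
  rw [integral_finsetSum _ fun j _ => hIt k j]
  refine Finset.sum_congr rfl fun j _ => ?_
  rw [integral_sub (hI1 k j) ((hI2 k j).const_mul _), integral_const_mul,
    integral_prod_symm _ (hI1 k j), integral_prod_symm _ (hI2 k j)]
  rfl

/-- First path. -/
def cone (y z : E2) (r : ℝ) : E2 := (1 + r)⁻¹ • (y + r • z)
/-- Second path. -/
def ctwo (y z : E2) (s : ℝ) : E2 := (1 - s) • y + s • z
/-- First weight. -/
def kone (r : ℝ) : ℝ := ((1 + r) ^ 2)⁻¹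

theorem S1_bound (ψ : E2 → ℝ) (hψ : ContDiff ℝ ∞ ψ) (hψs : HasCompactSupport ψ) :
    ∃ C : ℝ≥0∞, C ≠ ⊤ ∧ ∀ (F : E2 → ℝ) (j : Fin 2), ContDiff ℝ ∞ F → HasCompactSupport F →
      ∫⁻ y, ‖Sop 0 1 kone (cone y) ψ (pd j F)‖ₑ ^ 2 ≤ C * ∫⁻ x, ‖F x‖ₑ ^ 2 := by
  have hs' : ∀ f : E2 → ℝ, HasCompactSupport f → HasCompactSupport (fun x => (f x : ℂ)) :=
    fun f hf => hf.comp_left (g := fun r : ℝ => (r:ℂ)) (by simp)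
  have hc' : ∀ f : E2 → ℝ, ContDiff ℝ ∞ f → ContDiff ℝ ∞ (fun x => (f x : ℂ)) :=
    fun f hf => Complex.ofRealCLM.contDiff.comp hf
  let g : 𝓢(E2, ℂ) := (hs' ψ hψs).toSchwartzMap (hc' ψ hψ)
  obtain ⟨C, hC, h⟩ := U_bound g
  refine ⟨C, hC, fun F j hF hFs => ?_⟩
  let G : 𝓢(E2, ℂ) := (hs' F hFs).toSchwartzMap (hc' F hF)
  have h1 := h G (EuclideanSpace.single j 1) (by simp)
  have hd : ∀ x, (∂_{(EuclideanSpace.single j (1:ℝ) : E2)} G) x = ((pd j F x : ℝ) : ℂ) := by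
    intro x
    rw [SchwartzMap.lineDerivOp_apply_eq_fderiv]
    have e1 : HasFDerivAt (fun x => (F x : ℂ)) (Complex.ofRealCLM.comp (fderiv ℝ F x)) x :=
      Complex.ofRealCLM.hasFDerivAt.comp x ((hF.differentiable (by simp)) x).hasFDerivAt
    have e2 : fderiv ℝ (G : E2 → ℂ) x = Complex.ofRealCLM.comp (fderiv ℝ F x) := e1.fderiv
    rw [e2]
    rfl
  have hg : ∀ z, g z = (ψ z : ℂ) := fun z => rfl
  have hG : ∀ z, G z = (F z : ℂ) := fun z => rfl
  have key : ∀ y, ‖∫ r in Set.Ioc (0:ℝ) 1, ∫ z, g z * ((((1 + r) ^ 2)⁻¹ : ℝ) •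
      (∂_{(EuclideanSpace.single j (1:ℝ) : E2)} G) ((1 + r)⁻¹ • (y + r • z)))‖ₑ
      = ‖Sop 0 1 kone (cone y) ψ (pd j F)‖ₑ := by
    intro y
    have : ∫ r in Set.Ioc (0:ℝ) 1, ∫ z, g z * ((((1 + r) ^ 2)⁻¹ : ℝ) •
      (∂_{(EuclideanSpace.single j (1:ℝ) : E2)} G) ((1 + r)⁻¹ • (y + r • z)))
      = ((Sop 0 1 kone (cone y) ψ (pd j F) : ℝ) : ℂ) := by
      unfold Sop
      rw [← integral_complex_ofReal]
      refine integral_congr_ae (Filter.Eventually.of_forall fun r => ?_)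
      simp only
      rw [← integral_complex_ofReal]
      refine integral_congr_ae (Filter.Eventually.of_forall fun z => ?_)
      simp only [hd, hg, kone, cone, Complex.real_smul]
      push_cast
      rfl
    rw [this, ← ofReal_norm, ← ofReal_norm, Complex.norm_real]
  simp only [key] at h1
  refine h1.trans (le_of_eq ?_)
  congr 1
  refine lintegral_congr fun x => ?_
  rw [hG, ← ofReal_norm, ← ofReal_norm, Complex.norm_real]

theorem lint_affine (f : E2 → ℝ≥0∞) (hf : Measurable f) (v : E2) (s : ℝ) (hs : 1 / 2 ≤ s) :
    ∫⁻ x, f (v + s • x) ≤ 4 * ∫⁻ x, f x := by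
  have hR0 : s ≠ 0 := by positivity
  rw [← lintegral_map (f := fun x => f (v + x)) (hf.comp (measurable_const_add v))
    (measurable_const_smul s), Measure.map_addHaar_smul _ hR0,
    lintegral_smul_measure, lintegral_add_left_eq_self]
  refine mul_le_mul_left ?_ _
  rw [show (4:ℝ≥0∞) = ENNReal.ofReal 4 by simp]
  apply ENNReal.ofReal_le_ofReal
  rw [finrank_euclideanSpace_fin, abs_of_nonneg (by positivity)]
  rw [inv_le_comm₀ (by positivity) (by norm_num)]
  nlinarith

theorem S2_bound (ψ : E2 → ℝ) (hψ : ContDiff ℝ ∞ ψ) (hψs : HasCompactSupport ψ) (j : Fin 2) :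
    ∃ C : ℝ≥0∞, C ≠ ⊤ ∧ ∀ (F : E2 → ℝ), ContDiff ℝ ∞ F → HasCompactSupport F →
      ∀ y, ‖Sop (1/2) 1 (fun _ => 1) (ctwo y) ψ (pd j F)‖ₑ ^ 2 ≤ C * ∫⁻ x, ‖F x‖ₑ ^ 2 := by
  have hpc := pd_cont j ψ hψ
  have hps : HasCompactSupport (pd j ψ) := by
    have := hψs.fderiv (𝕜 := ℝ)
    refine this.comp_left (g := fun L : E2 →L[ℝ] ℝ => L (EuclideanSpace.single j 1)) (by simp)
  have hfin : ∫⁻ x, ‖pd j ψ x‖ₑ ^ 2 ≠ ⊤ := by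
    have := (hpc.memLp_of_hasCompactSupport hps (p := 2) (μ := (volume : Measure E2))).2
    have h3 := lintegral_rpow_enorm_lt_top_of_eLpNorm_lt_top (p := 2) (by norm_num) (by norm_num) this
    simpa using h3.ne
  refine ⟨16 * ∫⁻ x, ‖pd j ψ x‖ₑ ^ 2, ENNReal.mul_ne_top (by norm_num) hfin, fun F hF hFs y => ?_⟩
  set D : ℝ≥0∞ := (16 * ∫⁻ x, ‖pd j ψ x‖ₑ ^ 2) * ∫⁻ x, ‖F x‖ₑ ^ 2 with hD
  have hin : ∀ s ∈ Set.Ioc (1/2 : ℝ) 1,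
      ‖∫ z, ψ z * ((1:ℝ) * pd j F (ctwo y z s))‖ₑ ≤ D ^ (1/2 : ℝ) := by
    intro s hs
    have hs0 : 0 < s := by linarith [hs.1]
    let Fs : E2 → ℝ := fun z => F ((1 - s) • y + s • z)
    have hFsd : ∀ z, HasFDerivAt Fs ((fderiv ℝ F ((1 - s) • y + s • z)).comp
        (s • ContinuousLinearMap.id ℝ E2)) z := by
      intro z
      have h1 : HasFDerivAt (fun z : E2 => (1 - s) • y + s • z) (s • ContinuousLinearMap.id ℝ E2) z :=
        ((hasFDerivAt_id z).const_smul s).const_add _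
      exact ((hF.differentiable (by simp)) _).hasFDerivAt.comp z h1
    have hFsc : Continuous Fs := hF.continuous.comp (by fun_prop)
    have hpF : ∀ z, pd j Fs z = s * pd j F ((1 - s) • y + s • z) := by
      intro z
      unfold pd
      rw [(hFsd z).fderiv]
      simp
    have hpFc : Continuous (pd j Fs) := by
      have : pd j Fs = fun z => s * pd j F ((1 - s) • y + s • z) := funext hpF
      rw [this]
      exact continuous_const.mul ((pd_cont j F hF).comp (by fun_prop))
    have hbp : ∫ z, ψ z * pd j Fs z = - ∫ z, pd j ψ z * Fs z := by
      refine integral_mul_fderiv_eq_neg_fderiv_mul_of_integrable (μ := volume) (f := ψ) (g := Fs)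
        (v := EuclideanSpace.single j 1) ?_ ?_ ?_ ?_ ?_
      · exact (hpc.mul hFsc).integrable_of_hasCompactSupport hps.mul_right
      · exact (hψ.continuous.mul hpFc).integrable_of_hasCompactSupport hψs.mul_right
      · exact (hψ.continuous.mul hFsc).integrable_of_hasCompactSupport hψs.mul_right
      · exact fun z _ => hψ.differentiable (by simp) z
      · exact fun z _ => (hFsd z).differentiableAt
    have e1 : ∫ z, ψ z * ((1:ℝ) * pd j F (ctwo y z s)) = - (s⁻¹ * ∫ z, pd j ψ z * Fs z) := by
      have : ∫ z, ψ z * ((1:ℝ) * pd j F (ctwo y z s)) = s⁻¹ * ∫ z, ψ z * pd j Fs z := by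
        rw [← integral_const_mul]
        refine integral_congr_ae (Filter.Eventually.of_forall fun z => ?_)
        simp only [hpF, ctwo]
        field_simp
      rw [this, hbp]
      ring
    have hsq : ‖∫ z, ψ z * ((1:ℝ) * pd j F (ctwo y z s))‖ₑ ^ 2 ≤ D := by
      rw [e1, enorm_neg, enorm_mul, mul_pow]
      have h2 : ‖s⁻¹‖ₑ ^ 2 ≤ 4 := by
        rw [← ofReal_norm, ← ENNReal.ofReal_pow (norm_nonneg _),
          show (4:ℝ≥0∞) = ENNReal.ofReal 4 by simp]
        apply ENNReal.ofReal_le_ofReal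
        rw [Real.norm_of_nonneg (by positivity), inv_pow, inv_le_comm₀ (by positivity) (by norm_num)]
        nlinarith [hs.1]
      have h3 : ‖∫ z, pd j ψ z * Fs z‖ₑ ^ 2 ≤ (∫⁻ x, ‖pd j ψ x‖ₑ ^ 2) * (4 * ∫⁻ x, ‖F x‖ₑ ^ 2) := by
        refine (pow_le_pow_left' (enorm_integral_le_lintegral_enorm _) 2).trans ?_
        simp only [enorm_mul]
        refine (lint_cs volume _ _ hpc.measurable.enorm.aemeasurable
          hFsc.measurable.enorm.aemeasurable).trans ?_
        refine mul_le_mul_right ?_ _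
        exact lint_affine (fun x => ‖F x‖ₑ ^ 2) (hF.continuous.measurable.enorm.pow_const 2) _ s hs.1.le
      refine (mul_le_mul' h2 h3).trans (le_of_eq ?_)
      rw [hD]; ring
    calc _ = (‖∫ z, ψ z * ((1:ℝ) * pd j F (ctwo y z s))‖ₑ ^ 2) ^ (1/2 : ℝ) := by
          rw [← ENNReal.rpow_natCast, ← ENNReal.rpow_mul]; norm_num
      _ ≤ _ := ENNReal.rpow_le_rpow hsq (by norm_num)
  have hS : ‖Sop (1/2) 1 (fun _ => 1) (ctwo y) ψ (pd j F)‖ₑ ≤ D ^ (1/2 : ℝ) := by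
    unfold Sop
    refine (enorm_integral_le_lintegral_enorm _).trans ?_
    refine (setLIntegral_mono_ae' measurableSet_Ioc (Filter.Eventually.of_forall hin)).trans ?_
    rw [setLIntegral_const, Real.volume_Ioc]
    refine (mul_le_mul_right (ENNReal.ofReal_le_one.2 (by norm_num)) _).trans (mul_one _).le
  refine (pow_le_pow_left' hS 2).trans (le_of_eq ?_)
  rw [← ENNReal.rpow_natCast, ← ENNReal.rpow_mul]; norm_num

theorem enorm_sq_real (t : ℝ) : ‖t‖ₑ ^ 2 = ENNReal.ofReal (t ^ 2) := by
  rw [← ofReal_norm, ← ENNReal.ofReal_pow (norm_nonneg _), Real.norm_eq_abs, sq_abs]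

theorem Sop_meas (ψ h : E2 → ℝ) (hψ : Continuous ψ) (hh : Continuous h) :
    Measurable (fun y => Sop 0 1 kone (cone y) ψ h) := by
  have hk : Measurable kone := by unfold kone; fun_prop
  have hcone : Measurable (fun q : (E2 × ℝ) × E2 => cone q.1.1 q.2 q.1.2) := by
    unfold cone; fun_prop
  have h1 : StronglyMeasurable (fun q : (E2 × ℝ) × E2 =>
      ψ q.2 * (kone q.1.2 * h (cone q.1.1 q.2 q.1.2))) := by
    refine Measurable.stronglyMeasurable ?_
    exact (hψ.measurable.comp measurable_snd).mul
      ((hk.comp (measurable_snd.comp measurable_fst)).mul (hh.measurable.comp hcone))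
  have h2 : StronglyMeasurable (fun p : E2 × ℝ => ∫ z,
      ψ z * (kone p.2 * h (cone p.1 z p.2))) := h1.integral_prod_right
  exact (StronglyMeasurable.integral_prod_right (ν := volume.restrict (Set.Ioc (0:ℝ) 1)) h2).measurable

theorem cone_deriv (y z : E2) (r : ℝ) (hr : r ∈ Set.Icc (0:ℝ) 1) :
    HasDerivAt (cone y z) (kone r • (z - y)) r := by
  have hr0 : (1 + r) ≠ 0 := by have := hr.1; positivity
  have h1 : HasDerivAt (fun r : ℝ => (1 + r)⁻¹) (-(1:ℝ) / (1 + r) ^ 2) r :=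
    ((hasDerivAt_id r).const_add 1).inv hr0
  have h2 : HasDerivAt (fun r : ℝ => y + r • z) ((1:ℝ) • z) r :=
    ((hasDerivAt_id r).smul_const z).const_add y
  have h3 := h1.smul h2
  refine h3.congr_deriv ?_
  unfold kone
  ext i
  simp
  field_simp
  ring

theorem ctwo_deriv (y z : E2) (r : ℝ) :
    HasDerivAt (ctwo y z) ((1:ℝ) • (z - y)) r := by
  have h1 : HasDerivAt (fun r : ℝ => (1 - r) • y) ((-1:ℝ) • y) r :=
    ((hasDerivAt_id r).const_sub 1).smul_const y
  have h2 : HasDerivAt (fun r : ℝ => r • z) ((1:ℝ) • z) r :=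
    ((hasDerivAt_id r).smul_const z)
  refine (h1.add h2).congr_deriv ?_
  ext i
  simp
  ring

theorem core_bound (om : E2 → ℝ) (hom : ContDiff ℝ ∞ om) (homs : HasCompactSupport om)
    (hom1 : ∫ z, om z = 1) (R : ℝ) :
    ∃ C : ℝ≥0∞, C ≠ ⊤ ∧ ∀ (K : Set E2), Convex ℝ K → MeasurableSet K →
      K ⊆ Metric.closedBall 0 R → (∀ z, om z ≠ 0 → z ∈ K) →
      ∀ (ρ : E2 → ℝ) (F : Fin 2 → Fin 2 → E2 → ℝ),
      (∀ x ∈ K, DifferentiableAt ℝ ρ x) → (∀ k j, ContDiff ℝ ∞ (F k j)) →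
      (∀ k j, HasCompactSupport (F k j)) →
      (∀ x ∈ K, ∀ k, pd k ρ x = ∑ j, pd j (F k j) x) →
      ∫⁻ y in K, ‖ρ y - ∫ z, om z * ρ z‖ₑ ^ 2 ≤ C * ∑ k, ∑ j, ∫⁻ x, ‖F k j x‖ₑ ^ 2 := by
  have hok : ∀ k : Fin 2, ContDiff ℝ ∞ (fun z : E2 => z k * om z) := fun k => by
    have : ContDiff ℝ ∞ (fun z : E2 => z k) := by fun_prop
    exact this.mul hom
  have hoks : ∀ k : Fin 2, HasCompactSupport (fun z : E2 => z k * om z) := fun k => homs.mul_left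
  have homI : Integrable om := hom.continuous.integrable_of_hasCompactSupport homs
  have homkI : ∀ k : Fin 2, Integrable (fun z : E2 => z k * om z) := fun k =>
    (hok k).continuous.integrable_of_hasCompactSupport (hoks k)
  choose C1 hC1 h1 using fun k => S1_bound _ (hok k) (hoks k)
  obtain ⟨C0, hC0, h0⟩ := S1_bound om hom homs
  choose C2 hC2 h2 using fun k => fun j => S2_bound _ (hok k) (hoks k) j
  choose C3 hC3 h3 using fun j => S2_bound om hom homs j
  set V : ℝ≥0∞ := volume (Metric.closedBall (0:E2) R) with hV
  have hVt : V ≠ ⊤ := measure_closedBall_lt_top.ne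
  set D : Fin 2 → Fin 2 → ℝ≥0∞ := fun k j => C1 k + ENNReal.ofReal (R^2) * C0 +
    (C2 k j + ENNReal.ofReal (R^2) * C3 j) * V with hD
  refine ⟨16 * ∑ k, ∑ j, D k j, ?_, ?_⟩
  · refine ENNReal.mul_ne_top (by simp) ?_
    simp only [Fin.sum_univ_two, hD]
    simp [ENNReal.add_eq_top, ENNReal.mul_eq_top, hC1, hC0, hC2, hC3, hVt]
  intro K hK hKm hKR hoK ρ F hρ hF hFs hρF
  -- pointwise bound
  let S1k : Fin 2 → Fin 2 → E2 → ℝ := fun k j y =>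
    Sop 0 1 kone (cone y) (fun z => z k * om z) (pd j (F k j))
  let S10 : Fin 2 → Fin 2 → E2 → ℝ := fun k j y => Sop 0 1 kone (cone y) om (pd j (F k j))
  let S2k : Fin 2 → Fin 2 → E2 → ℝ := fun k j y =>
    Sop (1/2) 1 (fun _ => 1) (ctwo y) (fun z => z k * om z) (pd j (F k j))
  let S20 : Fin 2 → Fin 2 → E2 → ℝ := fun k j y =>
    Sop (1/2) 1 (fun _ => 1) (ctwo y) om (pd j (F k j))
  have hid : ∀ y ∈ K, ρ y - ∫ z, om z * ρ z =
      - ∑ k, ∑ j, ((S1k k j y - y k * S10 k j y) + (S2k k j y - y k * S20 k j y)) := by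
    intro y hy
    have hp1 := path_lemma y 0 1 zero_le_one kone (by unfold kone; fun_prop)
      (by
        unfold kone
        refine ContinuousOn.inv₀ (by fun_prop) ?_
        intro r hr
        have := hr.1
        positivity)
      (by
        intro r hr
        have := hr.1
        unfold kone
        rw [abs_of_nonneg (by positivity)]
        refine inv_le_one_of_one_le₀ ?_
        nlinarith) (cone y) (by unfold cone; fun_prop) om homI homkI K
      (by
        intro z hz r hr
        refine ⟨?_, cone_deriv y z r hr⟩
        have hr0 : 0 < 1 + r := by have := hr.1; positivity
        have : cone y z r = (1 + r)⁻¹ • y + ((1 + r)⁻¹ * r) • z := by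
          unfold cone; rw [smul_add, smul_smul]
        rw [this]
        refine hK hy (hoK z hz) (by positivity) (mul_nonneg (by positivity) hr.1) ?_
        field_simp) ρ F hρ hF hFs hρF
    have hp2 := path_lemma y (1/2) 1 (by norm_num) (fun _ => 1) (by fun_prop)
      (by fun_prop) (by simp) (ctwo y) (by unfold ctwo; fun_prop) om homI homkI K
      (by
        intro z hz r hr
        refine ⟨?_, ctwo_deriv y z r⟩
        exact hK hy (hoK z hz) (by linarith [hr.2]) (by linarith [hr.1]) (by ring)) ρ F hρ hF hFs hρF
    have hpt : ∀ z, om z * ρ z = om z * ρ y + (om z * (ρ (cone y z 1) - ρ (cone y z 0))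
        + om z * (ρ (ctwo y z 1) - ρ (ctwo y z (1/2)))) := by
      intro z
      have e0 : cone y z 0 = y := by simp [cone]
      have e1 : cone y z 1 = ctwo y z (1/2) := by
        ext i; simp [cone, ctwo]; ring
      have e2 : ctwo y z 1 = z := by simp [ctwo]
      rw [e0, e1, e2]
      ring
    have hi : ∫ z, om z * ρ z = ρ y + (∑ k, ∑ j, (S1k k j y - y k * S10 k j y) +
        ∑ k, ∑ j, (S2k k j y - y k * S20 k j y)) := by
      have hsum : Integrable (fun z => om z * (ρ (cone y z 1) - ρ (cone y z 0))
        + om z * (ρ (ctwo y z 1) - ρ (ctwo y z (1/2)))) := hp1.1.add hp2.1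
      rw [integral_congr_ae (Filter.Eventually.of_forall hpt),
        integral_add (homI.mul_const _) hsum, integral_mul_const, hom1, one_mul]
      congr 1
      rw [← hp1.2, ← hp2.2]
      exact integral_add hp1.1 hp2.1
    rw [hi]
    simp only [Finset.sum_add_distrib]
    ring
  have hyk : ∀ y ∈ K, ∀ k, (y k) ^ 2 ≤ R ^ 2 := by
    intro y hy k
    have h1 : ‖y‖ ≤ R := by simpa using hKR hy
    have h2 : ‖y k‖ ≤ ‖y‖ := PiLp.norm_apply_le y k
    rw [← sq_abs]
    exact pow_le_pow_left₀ (abs_nonneg _) (h2.trans h1) 2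
  have hpb : ∀ y ∈ K, ‖ρ y - ∫ z, om z * ρ z‖ₑ ^ 2 ≤ ∑ k, ∑ j, 16 *
      ((‖S1k k j y‖ₑ ^ 2 + ENNReal.ofReal (R^2) * ‖S10 k j y‖ₑ ^ 2) +
       (‖S2k k j y‖ₑ ^ 2 + ENNReal.ofReal (R^2) * ‖S20 k j y‖ₑ ^ 2)) := by
    intro y hy
    have hR : (0:ℝ) ≤ R ^ 2 := sq_nonneg R
    have hreal : (ρ y - ∫ z, om z * ρ z) ^ 2 ≤ ∑ k, ∑ j, 16 *
      (((S1k k j y) ^ 2 + R^2 * (S10 k j y) ^ 2) +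
       ((S2k k j y) ^ 2 + R^2 * (S20 k j y) ^ 2)) := by
      rw [hid y hy, neg_sq]
      have ht : ∀ a b c d t : ℝ, t ^ 2 ≤ R ^ 2 →
          ((a - t * b) + (c - t * d)) ^ 2 ≤ 4 * ((a^2 + R^2 * b^2) + (c^2 + R^2*d^2)) := by
        intro a b c d t ht
        have q1 : t^2 * b^2 ≤ R^2*b^2 := by gcongr
        have q2 : t^2 * d^2 ≤ R^2*d^2 := by gcongr
        nlinarith [sq_nonneg (a + t*b), sq_nonneg (a - c), sq_nonneg (a + t*d),
          sq_nonneg (t*b + c), sq_nonneg (t*b - t*d), sq_nonneg (c + t*d)]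
      have hs : ∀ a b c d : ℝ, ((a+b)+(c+d))^2 ≤ 4*(a^2+b^2+(c^2+d^2)) := by
        intro a b c d
        nlinarith [sq_nonneg (a-b), sq_nonneg (a - c), sq_nonneg (a - d),
          sq_nonneg (b - c), sq_nonneg (b-d), sq_nonneg (c - d)]
      simp only [Fin.sum_univ_two]
      refine (hs _ _ _ _).trans ?_
      have a1 := ht (S1k 0 0 y) (S10 0 0 y) (S2k 0 0 y) (S20 0 0 y) (y 0) (hyk y hy 0)
      have a2 := ht (S1k 0 1 y) (S10 0 1 y) (S2k 0 1 y) (S20 0 1 y) (y 0) (hyk y hy 0)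
      have a3 := ht (S1k 1 0 y) (S10 1 0 y) (S2k 1 0 y) (S20 1 0 y) (y 1) (hyk y hy 1)
      have a4 := ht (S1k 1 1 y) (S10 1 1 y) (S2k 1 1 y) (S20 1 1 y) (y 1) (hyk y hy 1)
      linarith
    rw [enorm_sq_real]
    refine (ENNReal.ofReal_le_ofReal hreal).trans (le_of_eq ?_)
    simp only [enorm_sq_real]
    rw [ENNReal.ofReal_sum_of_nonneg (fun _ _ => by positivity)]
    refine Finset.sum_congr rfl fun k _ => ?_
    rw [ENNReal.ofReal_sum_of_nonneg (fun _ _ => by positivity)]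
    refine Finset.sum_congr rfl fun j _ => ?_
    rw [ENNReal.ofReal_mul (by norm_num), ENNReal.ofReal_add (by positivity) (by positivity),
      ENNReal.ofReal_add (by positivity) (by positivity),
      ENNReal.ofReal_add (by positivity) (by positivity), ENNReal.ofReal_mul hR,
      ENNReal.ofReal_mul hR]
    simp
  have hm1 : ∀ k j, Measurable (fun y => ‖S1k k j y‖ₑ ^ 2) := fun k j =>
    (Sop_meas _ _ (hok k).continuous (pd_cont j _ (hF k j))).enorm.pow_const 2
  have hm0 : ∀ k j, Measurable (fun y => ‖S10 k j y‖ₑ ^ 2) := fun k j =>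
    (Sop_meas _ _ hom.continuous (pd_cont j _ (hF k j))).enorm.pow_const 2
  let N : Fin 2 → Fin 2 → ℝ≥0∞ := fun k j => ∫⁻ x, ‖F k j x‖ₑ ^ 2
  have hterm : ∀ k j, ∫⁻ y in K, 16 *
      ((‖S1k k j y‖ₑ ^ 2 + ENNReal.ofReal (R^2) * ‖S10 k j y‖ₑ ^ 2) +
       (C2 k j * N k j + ENNReal.ofReal (R^2) * (C3 j * N k j))) ≤ 16 * (D k j * N k j) := by
    intro k j
    rw [lintegral_const_mul _ (by have := hm1 k j; have := hm0 k j; fun_prop)]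
    gcongr
    rw [lintegral_add_right _ measurable_const, lintegral_add_left (hm1 k j),
      lintegral_const_mul _ (hm0 k j), setLIntegral_const]
    have b1 : ∫⁻ y in K, ‖S1k k j y‖ₑ ^ 2 ≤ C1 k * N k j :=
      (setLIntegral_le_lintegral _ _).trans (h1 k (F k j) j (hF k j) (hFs k j))
    have b0 : ∫⁻ y in K, ‖S10 k j y‖ₑ ^ 2 ≤ C0 * N k j :=
      (setLIntegral_le_lintegral _ _).trans (h0 (F k j) j (hF k j) (hFs k j))
    have bv : volume K ≤ V := measure_mono hKR
    calc _ ≤ C1 k * N k j + ENNReal.ofReal (R^2) * (C0 * N k j) +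
          (C2 k j * N k j + ENNReal.ofReal (R^2) * (C3 j * N k j)) * V := by gcongr
      _ = _ := by simp only [hD]; ring
  calc ∫⁻ y in K, ‖ρ y - ∫ z, om z * ρ z‖ₑ ^ 2
      ≤ ∫⁻ y in K, ∑ k, ∑ j, 16 *
      ((‖S1k k j y‖ₑ ^ 2 + ENNReal.ofReal (R^2) * ‖S10 k j y‖ₑ ^ 2) +
       (C2 k j * N k j + ENNReal.ofReal (R^2) * (C3 j * N k j))) := by
        refine setLIntegral_mono' hKm fun y hy => (hpb y hy).trans ?_
        gcongr with k _ j _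
        · exact h2 k j (F k j) (hF k j) (hFs k j) y
        · exact h3 j (F k j) (hF k j) (hFs k j) y
    _ = ∑ k, ∑ j, ∫⁻ y in K, 16 *
      ((‖S1k k j y‖ₑ ^ 2 + ENNReal.ofReal (R^2) * ‖S10 k j y‖ₑ ^ 2) +
       (C2 k j * N k j + ENNReal.ofReal (R^2) * (C3 j * N k j))) := by
        have hmm : ∀ k j, Measurable (fun y => 16 *
          ((‖S1k k j y‖ₑ ^ 2 + ENNReal.ofReal (R^2) * ‖S10 k j y‖ₑ ^ 2) +
          (C2 k j * N k j + ENNReal.ofReal (R^2) * (C3 j * N k j)))) := fun k j => by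
          have := hm1 k j; have := hm0 k j; fun_prop
        rw [lintegral_finsetSum _ fun k _ => Finset.measurable_fun_sum _ fun j _ => hmm k j]
        refine Finset.sum_congr rfl fun k _ => ?_
        rw [lintegral_finsetSum _ fun j _ => hmm k j]
    _ ≤ ∑ k, ∑ j, 16 * ((∑ k, ∑ j, D k j) * N k j) := by
        refine Finset.sum_le_sum fun k _ => Finset.sum_le_sum fun j _ => (hterm k j).trans ?_
        gcongr
        calc D k j ≤ ∑ j, D k j := Finset.single_le_sum (f := fun j => D k j) (fun _ _ => zero_le) (Finset.mem_univ j)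
          _ ≤ _ := Finset.single_le_sum (f := fun k => ∑ j, D k j) (fun _ _ => zero_le) (Finset.mem_univ k)
    _ = _ := by
        simp only [← Finset.mul_sum, N]
        ring

theorem cutoff_exists (K Ω : Set E2) (hK : IsCompact K) (hΩ : IsOpen Ω) (hKΩ : K ⊆ Ω) :
    ∃ χ : E2 → ℝ, ContDiff ℝ ∞ χ ∧ HasCompactSupport χ ∧ tsupport χ ⊆ Ω ∧
      (∀ x, 0 ≤ χ x ∧ χ x ≤ 1) ∧ ∀ x ∈ K, ∀ᶠ z in 𝓝 x, χ z = 1 := by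
  obtain ⟨K1, hK1, h01, h1⟩ := exists_compact_between hK hΩ hKΩ
  obtain ⟨K2, hK2, h12, h2⟩ := exists_compact_between hK1 hΩ h1
  obtain ⟨χ, hχ, hr, hs, h⟩ := exists_contMDiff_support_eq_eq_one_iff (n := (⊤ : ℕ∞)) (𝓘(ℝ, E2))
    isOpen_interior hK1.isClosed h12
  have hts : tsupport χ ⊆ K2 := by
    rw [tsupport, hs]
    exact closure_minimal interior_subset hK2.isClosed
  refine ⟨χ, hχ.contDiff, HasCompactSupport.of_support_subset_isCompact hK2
    ((subset_tsupport _).trans hts), hts.trans h2, fun x => hr ⟨x, rfl⟩, fun x hx => ?_⟩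
  filter_upwards [mem_interior_iff_mem_nhds.1 (h01 hx)] with z hz
  exact (h z).1 hz

theorem domain_bound (Ω : Set E2) (hne : Ω.Nonempty) (hbd : Bornology.IsBounded Ω)
    (hconv : Convex ℝ Ω) (hopen : IsOpen Ω) :
    ∃ C : ℝ≥0∞, C ≠ ⊤ ∧ ∀ (ρ : E2 → ℝ) (B : Fin 2 → Fin 2 → E2 → ℝ),
      (∀ x ∈ Ω, DifferentiableAt ℝ ρ x) → (∀ k j, ContDiffOn ℝ ∞ (B k j) Ω) →
      (∀ x ∈ Ω, ∀ k, pd k ρ x = ∑ j, pd j (B k j) x) →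
      ∃ c : ℝ, ∫⁻ y in Ω, ‖ρ y - c‖ₑ ^ 2 ≤ C * ∑ k, ∑ j, ∫⁻ x in Ω, ‖B k j x‖ₑ ^ 2 := by
  obtain ⟨x0, hx0⟩ := hne
  obtain ⟨δ', hδ', hball⟩ := Metric.isOpen_iff.1 hopen x0 hx0
  obtain ⟨R, hR⟩ := hbd.subset_closedBall 0
  set δ := δ' / 2 with hδdef
  have hδ : 0 < δ := by positivity
  let f : ContDiffBump x0 := ⟨δ / 2, δ, by positivity, by linarith⟩
  obtain ⟨C, hC, hb⟩ := core_bound (f.normed volume) f.contDiff_normed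
    f.hasCompactSupport_normed f.integral_normed R
  refine ⟨C, hC, fun ρ B hρ hB hρB => ⟨∫ z, f.normed volume z * ρ z, ?_⟩⟩
  set c := ∫ z, f.normed volume z * ρ z with hc
  let K : ℕ → Set E2 := fun n => {x | Metric.ball x (δ / (n + 1)) ⊆ Ω}
  have hKpos : ∀ n : ℕ, 0 < δ / ((n:ℝ) + 1) := fun n => by positivity
  have hKle : ∀ n : ℕ, δ / ((n:ℝ) + 1) ≤ δ := fun n =>
    div_le_self hδ.le (by have : (0:ℝ) ≤ n := Nat.cast_nonneg n; linarith)
  have hKΩ : ∀ n, K n ⊆ Ω := fun n x hx => hx (Metric.mem_ball_self (hKpos n))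
  have hKclosed : ∀ n, IsClosed (K n) := by
    intro n
    rw [← isOpen_compl_iff, Metric.isOpen_iff]
    intro x hx
    simp only [K, Set.mem_compl_iff, Set.mem_ofPred_eq, Set.not_subset] at hx
    obtain ⟨w, hw, hwΩ⟩ := hx
    rw [Metric.mem_ball] at hw
    refine ⟨δ / ((n:ℝ) + 1) - dist w x, by linarith, fun y hy hyK => hwΩ (hyK ?_)⟩
    rw [Metric.mem_ball] at hy ⊢
    have := dist_triangle w x y
    rw [dist_comm x y] at this
    linarith
  have hKcpt : ∀ n, IsCompact (K n) := fun n =>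
    Metric.isCompact_of_isClosed_isBounded (hKclosed n) (hbd.subset (hKΩ n))
  have hKconv : ∀ n, Convex ℝ (K n) := by
    intro n x hx y hy a b ha hb hab w hw
    have hv : ‖w - (a • x + b • y)‖ < δ / ((n:ℝ) + 1) := by
      rwa [Metric.mem_ball, dist_eq_norm] at hw
    set v := w - (a • x + b • y) with hvdef
    have e : w = a • (x + v) + b • (y + v) := by
      have : a • v + b • v = v := by rw [← add_smul, hab, one_smul]
      calc w = (a • x + b • y) + v := by rw [hvdef]; abel
        _ = (a • x + b • y) + (a • v + b • v) := by rw [this]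
        _ = _ := by rw [smul_add, smul_add]; abel
    rw [e]
    refine hconv (hx ?_) (hy ?_) ha hb hab
    · simpa [Metric.mem_ball, dist_eq_norm] using hv
    · simpa [Metric.mem_ball, dist_eq_norm] using hv
  have hKmono : Monotone K := by
    intro n m hnm x hx
    refine (Metric.ball_subset_ball ?_).trans hx
    have : (n:ℝ) ≤ m := by exact_mod_cast hnm
    gcongr
  have hKU : ⋃ n, K n = Ω := by
    refine Set.Subset.antisymm (Set.iUnion_subset hKΩ) fun x hx => ?_
    obtain ⟨ε, hε, hεb⟩ := Metric.isOpen_iff.1 hopen x hx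
    obtain ⟨n, hn⟩ := exists_nat_gt (δ / ε)
    refine Set.mem_iUnion.2 ⟨n, (Metric.ball_subset_ball ?_).trans hεb⟩
    rw [div_lt_iff₀ hε] at hn
    rw [div_le_iff₀ (by positivity)]
    nlinarith
  have homK : ∀ n, ∀ z, f.normed volume z ≠ 0 → z ∈ K n := by
    intro n z hz w hw
    have h1 : z ∈ Function.support (f.normed volume) := hz
    rw [f.support_normed_eq, Metric.mem_ball] at h1
    have h1' : dist z x0 < δ := h1
    rw [Metric.mem_ball] at hw
    apply hball
    rw [Metric.mem_ball]
    have := dist_triangle w z x0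
    have := hKle n
    linarith
  conv_lhs => rw [← hKU]
  rw [setLIntegral_iUnion_of_directed _ hKmono.directed_le]
  refine iSup_le fun n => ?_
  obtain ⟨χ, hχ, hχs, hχΩ, hχ01, hχ1⟩ := cutoff_exists (K n) Ω (hKcpt n) hopen (hKΩ n)
  have hFs : ∀ k j, HasCompactSupport (fun x => χ x * B k j x) := fun k j => hχs.mul_right
  have hF : ∀ k j, ContDiff ℝ ∞ (fun x => χ x * B k j x) := by
    intro k j
    rw [contDiff_iff_contDiffAt]
    intro x
    by_cases hx : x ∈ Ω
    · exact hχ.contDiffAt.mul ((hB k j).contDiffAt (hopen.mem_nhds hx))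
    · have hx' : x ∉ tsupport χ := fun h => hx (hχΩ h)
      rw [notMem_tsupport_iff_eventuallyEq] at hx'
      have : (fun x => χ x * B k j x) =ᶠ[𝓝 x] fun _ => 0 := by
        filter_upwards [hx'] with z hz
        simp [hz]
      exact contDiffAt_const.congr_of_eventuallyEq this
  refine (hb (K n) (hKconv n) (hKclosed n).measurableSet ((hKΩ n).trans hR) (homK n) ρ
    (fun k j x => χ x * B k j x) (fun x hx => hρ x (hKΩ n hx)) hF hFs ?_).trans ?_
  · intro x hx k
    rw [hρB x (hKΩ n hx) k]
    refine Finset.sum_congr rfl fun j _ => ?_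
    have : (fun x => χ x * B k j x) =ᶠ[𝓝 x] B k j := by
      filter_upwards [hχ1 x hx] with z hz
      simp [hz]
    unfold pd
    rw [this.fderiv_eq]
  · refine mul_le_mul' le_rfl (Finset.sum_le_sum fun k _ => Finset.sum_le_sum fun j _ => ?_)
    rw [← lintegral_indicator hopen.measurableSet]
    refine lintegral_mono fun x => ?_
    by_cases hx : x ∈ Ω
    · rw [Set.indicator_of_mem hx]
      dsimp only
      rw [enorm_mul]
      gcongr
      have h1 : ‖χ x‖ₑ ≤ 1 := by
        rw [← ofReal_norm, Real.norm_of_nonneg (hχ01 x).1]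
        simpa using (hχ01 x).2
      calc _ ≤ 1 * ‖B k j x‖ₑ := by gcongr
        _ = _ := one_mul _
    · have : χ x = 0 := by
        by_contra h
        exact hx (hχΩ (subset_tsupport _ h))
      simp [this]

theorem potential_exists (Ω : Set E2) (hconv : Convex ℝ Ω) (hopen : IsOpen Ω) (g0 g1 : E2 → ℝ)
    (h0 : ContDiffOn ℝ ∞ g0 Ω) (h1 : ContDiffOn ℝ ∞ g1 Ω)
    (hcl : ∀ x ∈ Ω, pd 1 g0 x = pd 0 g1 x) :
    ∃ f : E2 → ℝ, ContDiffOn ℝ ∞ f Ω ∧ ∀ x ∈ Ω, pd 0 f x = g0 x ∧ pd 1 f x = g1 x := by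
  let P : Fin 2 → E2 →L[ℝ] ℝ := fun i => EuclideanSpace.proj i
  have hP : ∀ i (v : E2), P i v = v i := fun i v => rfl
  let w : E2 → E2 →L[ℝ] ℝ := fun x => g0 x • P 0 + g1 x • P 1
  have hw : ContDiffOn ℝ ∞ w Ω := (h0.smul contDiffOn_const).add (h1.smul contDiffOn_const)
  have hd0 : ∀ x ∈ Ω, DifferentiableAt ℝ g0 x := fun x hx =>
    (h0.contDiffAt (hopen.mem_nhds hx)).differentiableAt (by simp)
  have hd1 : ∀ x ∈ Ω, DifferentiableAt ℝ g1 x := fun x hx =>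
    (h1.contDiffAt (hopen.mem_nhds hx)).differentiableAt (by simp)
  obtain ⟨f, hf⟩ := hconv.exists_forall_hasFDerivAt_of_fderiv_symmetric hopen
    (hw.differentiableOn (by simp)) (by
      intro a ha x y
      have e : HasFDerivAt w ((fderiv ℝ g0 a).smulRight (P 0) + (fderiv ℝ g1 a).smulRight (P 1)) a :=
        have q0 : HasFDerivAt (fun x => g0 x • P 0) ((fderiv ℝ g0 a).smulRight (P 0)) a :=
          (hd0 a ha).hasFDerivAt.smul_const (P 0)
        have q1 : HasFDerivAt (fun x => g1 x • P 1) ((fderiv ℝ g1 a).smulRight (P 1)) a :=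
          (hd1 a ha).hasFDerivAt.smul_const (P 1)
        q0.add q1
      rw [e.fderiv]
      simp only [add_apply, ContinuousLinearMap.smulRight_apply, smul_eq_mul,
        FunLike.coe_smul, Pi.smul_apply, fderiv_expand, Fin.sum_univ_two, hcl a ha,
        hP]
      ring)
  refine ⟨f, ?_, ?_⟩
  · rw [contDiffOn_infty_iff_fderiv_of_isOpen hopen]
    refine ⟨fun x hx => (hf x hx).differentiableAt.differentiableWithinAt, ?_⟩
    exact hw.congr fun x hx => (hf x hx).fderiv
  · intro x hx
    unfold pd
    rw [(hf x hx).fderiv]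
    simp [w, P]

theorem pd_contDiffOn (Ω : Set E2) (hopen : IsOpen Ω) (j : Fin 2) (f : E2 → ℝ)
    (hf : ContDiffOn ℝ ∞ f Ω) : ContDiffOn ℝ ∞ (pd j f) Ω := by
  have := ((contDiffOn_infty_iff_fderiv_of_isOpen hopen).1 hf).2
  exact this.clm_apply contDiffOn_const

theorem pd_congr_on (Ω : Set E2) (hopen : IsOpen Ω) (j : Fin 2) (f g : E2 → ℝ)
    (h : ∀ x ∈ Ω, f x = g x) (x : E2) (hx : x ∈ Ω) : pd j f x = pd j g x := by
  have : f =ᶠ[𝓝 x] g := by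
    filter_upwards [hopen.mem_nhds hx] with z hz using h z hz
  unfold pd
  rw [this.fderiv_eq]

theorem pd_neg' (j : Fin 2) (f : E2 → ℝ) (x : E2) : pd j (fun y => - f y) x = - pd j f x := by
  unfold pd
  rw [show (fun y => - f y) = -f from rfl, fderiv_neg]
  rfl

theorem pd_add' (j : Fin 2) (f g : E2 → ℝ) (x : E2) (hf : DifferentiableAt ℝ f x)
    (hg : DifferentiableAt ℝ g x) : pd j (fun y => f y + g y) x = pd j f x + pd j g x := by
  unfold pd
  rw [fderiv_fun_add hf hg]
  rfl

theorem main_aux (Ω : Set E2) (hne : Ω.Nonempty) (hbd : Bornology.IsBounded Ω)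
    (hconv : Convex ℝ Ω) (hopen : IsOpen Ω) :
    ∃ C : ℝ, 0 < C ∧
      ∀ A : E2 → Matrix (Fin 2) (Fin 2) ℝ,
        (∀ i j, ContDiffOn ℝ (⊤ : ℕ∞) (fun x => A x i j) Ω) →
        (∀ x ∈ Ω, (A x).IsSymm) →
        (∀ x ∈ Ω, divDiv A x = 0) →
        IntegrableOn (fun x => frob (A x) (A x)) Ω →
        ∃ θ : E2 → Fin 2 → ℝ,
          (∀ i, ContDiffOn ℝ (⊤ : ℕ∞) (fun x => θ x i) Ω) ∧
          (∀ x ∈ Ω, symCurl θ x = A x) ∧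
          (∫ x in Ω, frob (jac θ x) (jac θ x)) ≤ C * ∫ x in Ω, frob (A x) (A x) := by
  obtain ⟨C, hC, hb⟩ := domain_bound Ω hne hbd hconv hopen
  refine ⟨1 + 2 * C.toReal, by positivity, fun A hA hsym hdd hAi => ?_⟩
  have hdiff : ∀ f : E2 → ℝ, ContDiffOn ℝ ∞ f Ω → ∀ x ∈ Ω, DifferentiableAt ℝ f x :=
    fun f hf x hx => (hf.contDiffAt (hopen.mem_nhds hx)).differentiableAt (by simp)
  have hdiv : ∀ i, ContDiffOn ℝ ∞ (fun y => divMat A y i) Ω := fun i =>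
    (pd_contDiffOn Ω hopen 0 _ (hA i 0)).add (pd_contDiffOn Ω hopen 1 _ (hA i 1))
  obtain ⟨ρ0, hρ0, hρ0d⟩ := potential_exists Ω hconv hopen (fun y => divMat A y 1)
    (fun y => - divMat A y 0) (hdiv 1) (hdiv 0).neg (by
      intro x hx
      rw [pd_neg']
      have := hdd x hx
      unfold divDiv at this
      linarith)
  let B : Fin 2 → Fin 2 → E2 → ℝ := fun k j x => if k = 0 then A x 1 j else - A x 0 j
  have hB0 : ∀ j, B 0 j = fun x => A x 1 j := fun j => by funext x; simp [B]
  have hB1 : ∀ j, B 1 j = fun x => - A x 0 j := fun j => by funext x; simp [B]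
  have hB : ∀ k j, ContDiffOn ℝ ∞ (B k j) Ω := by
    intro k j
    fin_cases k
    · change ContDiffOn ℝ ∞ (B 0 j) Ω
      rw [hB0]; exact hA 1 j
    · change ContDiffOn ℝ ∞ (B 1 j) Ω
      rw [hB1]; exact (hA 0 j).neg
  obtain ⟨c, hc⟩ := hb ρ0 B (hdiff ρ0 hρ0) hB (by
    intro x hx k
    fin_cases k
    · change pd 0 ρ0 x = ∑ j, pd j (B 0 j) x
      rw [(hρ0d x hx).1, Fin.sum_univ_two, hB0, hB0]
      rfl
    · change pd 1 ρ0 x = ∑ j, pd j (B 1 j) x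
      rw [(hρ0d x hx).2, Fin.sum_univ_two, hB1, hB1, pd_neg', pd_neg']
      unfold divMat
      ring)
  let ρ : E2 → ℝ := fun x => ρ0 x - c
  have hρ : ContDiffOn ℝ ∞ ρ Ω := hρ0.sub contDiffOn_const
  have hρd : ∀ j x, pd j ρ x = pd j ρ0 x := by
    intro j x
    simp only [pd, ρ, fderiv_sub_const]
  have hs : ∀ x ∈ Ω, A x 1 0 = A x 0 1 := fun x hx => (hsym x hx).apply 0 1
  obtain ⟨t0, ht0, ht0d⟩ := potential_exists Ω hconv hopen (fun y => - (A y 0 1 + ρ y))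
    (fun y => A y 0 0) ((hA 0 1).add hρ).neg (hA 0 0) (by
      intro x hx
      rw [pd_neg', pd_add' _ _ _ _ (hdiff _ (hA 0 1) x hx) (hdiff _ hρ x hx), hρd,
        (hρ0d x hx).2]
      unfold divMat
      ring)
  obtain ⟨t1, ht1, ht1d⟩ := potential_exists Ω hconv hopen (fun y => - A y 1 1)
    (fun y => A y 1 0 + - ρ y) (hA 1 1).neg ((hA 1 0).add hρ.neg) (by
      intro x hx
      rw [pd_neg', pd_add' _ _ _ _ (hdiff _ (hA 1 0) x hx) (hdiff _ hρ.neg x hx), pd_neg', hρd,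
        (hρ0d x hx).1]
      unfold divMat
      ring)
  have hfrob : ∀ M : Matrix (Fin 2) (Fin 2) ℝ, frob M M =
      M 0 0 ^ 2 + M 0 1 ^ 2 + (M 1 0 ^ 2 + M 1 1 ^ 2) := by
    intro M
    simp only [frob, Fin.sum_univ_two]
    ring
  have hfnn : ∀ M : Matrix (Fin 2) (Fin 2) ℝ, 0 ≤ frob M M := by
    intro M
    rw [hfrob]
    positivity
  refine ⟨fun x => ![t0 x, t1 x], ?_, ?_, ?_⟩
  · intro i
    fin_cases i
    · exact ht0
    · exact ht1
  · intro x hx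
    have a1 := ht0d x hx
    have a2 := ht1d x hx
    have a3 := hs x hx
    ext i j
    fin_cases i <;> fin_cases j <;>
      simp [symCurl, curlVec, a1.1, a1.2, a2.1, a2.2] <;> linarith
  · have hjac : ∀ x ∈ Ω, frob (jac (fun x => ![t0 x, t1 x]) x) (jac (fun x => ![t0 x, t1 x]) x)
        = frob (A x) (A x) + 2 * (ρ x) ^ 2 := by
      intro x hx
      have a1 := ht0d x hx
      have a2 := ht1d x hx
      have a3 := hs x hx
      rw [hfrob, hfrob]
      simp [jac, a1.1, a1.2, a2.1, a2.2]
      rw [a3]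
      ring
    rw [setIntegral_congr_fun hopen.measurableSet hjac]
    have hBm : ∀ k j, AEMeasurable (fun x => ‖B k j x‖ₑ ^ 2) (volume.restrict Ω) := fun k j =>
      (((hB k j).continuousOn.aemeasurable hopen.measurableSet).enorm).pow_const 2
    have hsum : ∑ k, ∑ j, ∫⁻ x in Ω, ‖B k j x‖ₑ ^ 2
        = ENNReal.ofReal (∫ x in Ω, frob (A x) (A x)) := by
      rw [ofReal_integral_eq_lintegral_ofReal hAi (Filter.Eventually.of_forall fun x => hfnn _)]
      simp only [Fin.sum_univ_two]
      have hBm2 : AEMeasurable (fun x => ‖B 0 0 x‖ₑ ^ 2 + ‖B 0 1 x‖ₑ ^ 2) (volume.restrict Ω) :=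
        (hBm 0 0).add (hBm 0 1)
      rw [← lintegral_add_left' (hBm 0 0), ← lintegral_add_left' (hBm 1 0),
        ← lintegral_add_left' hBm2]
      refine lintegral_congr fun x => ?_
      simp only [Pi.add_apply, enorm_sq_real]
      rw [← ENNReal.ofReal_add (by positivity) (by positivity),
        ← ENNReal.ofReal_add (by positivity) (by positivity),
        ← ENNReal.ofReal_add (by positivity) (by positivity), hfrob, hB0, hB0, hB1, hB1]
      congr 1
      ring
    rw [hsum] at hc
    set I := ∫ x in Ω, frob (A x) (A x) with hI
    have hI0 : 0 ≤ I := integral_nonneg fun x => hfnn _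
    have hρm : AEStronglyMeasurable (fun x => ρ x ^ 2) (volume.restrict Ω) :=
      (hρ.continuousOn.pow 2).aestronglyMeasurable hopen.measurableSet
    have hc' : ∫⁻ x in Ω, ENNReal.ofReal (ρ x ^ 2) ≤ C * ENNReal.ofReal I := by
      simpa only [enorm_sq_real] using hc
    have hfin : C * ENNReal.ofReal I ≠ ⊤ := ENNReal.mul_ne_top hC ENNReal.ofReal_ne_top
    have hρi : IntegrableOn (fun x => ρ x ^ 2) Ω := by
      refine ⟨hρm, ?_⟩
      rw [hasFiniteIntegral_iff_ofReal (Filter.Eventually.of_forall fun x => sq_nonneg _)]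
      exact lt_of_le_of_lt hc' hfin.lt_top
    have hρI : ∫ x in Ω, ρ x ^ 2 ≤ C.toReal * I := by
      rw [integral_eq_lintegral_of_nonneg_ae (Filter.Eventually.of_forall fun x => sq_nonneg _) hρm]
      refine (ENNReal.toReal_mono hfin hc').trans (le_of_eq ?_)
      rw [ENNReal.toReal_mul, ENNReal.toReal_ofReal hI0]
    rw [integral_add hAi (hρi.const_mul 2), integral_const_mul]
    linarith

end Aux

/-- Smooth-data version of the regularized right-inverse of the symcurl operator. -/
theorem statement0 (Ω : Set E2) (hne : Ω.Nonempty) (hbd : Bornology.IsBounded Ω)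
    (hconv : Convex ℝ Ω) (hopen : IsOpen Ω) :
    ∃ C : ℝ, 0 < C ∧
      ∀ A : E2 → Matrix (Fin 2) (Fin 2) ℝ,
        (∀ i j, ContDiffOn ℝ (⊤ : ℕ∞) (fun x => A x i j) Ω) →
        (∀ x ∈ Ω, (A x).IsSymm) →
        (∀ x ∈ Ω, divDiv A x = 0) →
        IntegrableOn (fun x => frob (A x) (A x)) Ω →
        ∃ θ : E2 → Fin 2 → ℝ,
          (∀ i, ContDiffOn ℝ (⊤ : ℕ∞) (fun x => θ x i) Ω) ∧
          (∀ x ∈ Ω, symCurl θ x = A x) ∧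
          (∫ x in Ω, frob (jac θ x) (jac θ x)) ≤ C * ∫ x in Ω, frob (A x) (A x) := by
  exact main_aux Ω hne hbd hconv hopen

end
end

section
/- Let Ω ⊆ ℝ² be a connected open set and let θ : Ω → ℝ² be a C¹ vector field. Then symcurl θ = 0 on Ω if and only if there exist a ∈ ℝ² and c ∈ ℝ such that θ(x) = a + c·x for all x ∈ Ω. (Exactness of the two-dimensional div-div complex at H¹: the kernel of symcurl is the lowest-order Raviart–Thomas space RT₀, the span of (1,0), (0,1) and (x₁,x₂).) -/
open MeasureTheory

noncomputable section

theorem aux_translate (f : E2 → ℝ) (B : Set E2) (hB : IsOpen B) (hc : Convex ℝ B)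
    (hd : DifferentiableOn ℝ f B) (j : Fin 2) (h0 : ∀ x ∈ B, pd j f x = 0)
    (p : E2) (hp : p ∈ B) (t : ℝ) (hq : p + t • EuclideanSpace.single j (1 : ℝ) ∈ B) :
    fderiv ℝ f (p + t • EuclideanSpace.single j (1 : ℝ)) = fderiv ℝ f p := by
  set w : E2 := t • EuclideanSpace.single j (1 : ℝ) with hw
  have key : ∀ y ∈ B, y + w ∈ B → f (y + w) = f y := by
    intro y hy hyw
    obtain ⟨z, hz, h⟩ := domain_mvt (f := f) (s := B) (f' := fun x => fderiv ℝ f x)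
      (fun x hx => ((hd x hx).differentiableAt
        (hB.mem_nhds hx)).hasFDerivAt.hasFDerivWithinAt) hc hy hyw
    have hzB : z ∈ B := hc.segment_subset hy hyw hz
    have := h0 z hzB
    unfold pd at this
    rw [add_sub_cancel_left, hw, map_smul, this] at h
    simp at h
    linarith
  rw [← fderiv_comp_add_right w]
  apply Filter.EventuallyEq.fderiv_eq
  have h2 : ∀ᶠ y in nhds p, y + w ∈ B :=
    (continuous_add_const w).continuousAt.eventually (hB.mem_nhds hq)
  filter_upwards [hB.mem_nhds hp, h2] with y hy hyw using key y hy hyw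

theorem aux_decomp (x : E2) : x = x 0 • EuclideanSpace.single 0 (1 : ℝ)
    + x 1 • EuclideanSpace.single 1 (1 : ℝ) := by
  ext i
  fin_cases i <;> simp

theorem aux_ext (L M : E2 →L[ℝ] ℝ)
    (h : ∀ i, L (EuclideanSpace.single i 1) = M (EuclideanSpace.single i 1)) : L = M := by
  ext x
  rw [aux_decomp x]
  simp only [map_add, map_smul, h]

theorem aux_symCurl (θ : E2 → Fin 2 → ℝ) (x : E2) : symCurl θ x = 0 ↔
    pd 1 (fun y => θ y 0) x = 0 ∧ pd 0 (fun y => θ y 1) x = 0 ∧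
    pd 1 (fun y => θ y 1) x = pd 0 (fun y => θ y 0) x := by
  rw [← Matrix.ext_iff]
  simp only [symCurl, curlVec, Fin.forall_fin_two, Matrix.smul_apply, Matrix.add_apply,
    Matrix.transpose_apply, Matrix.of_apply, Matrix.zero_apply, smul_eq_mul, if_true,
    one_ne_zero, if_false]
  constructor
  · rintro ⟨⟨h1, h2⟩, h3, h4⟩
    refine ⟨?_, ?_, ?_⟩ <;> linarith
  · rintro ⟨h1, h2, h3⟩
    refine ⟨⟨?_, ?_⟩, ?_, ?_⟩ <;> linarith

/-- derivative of an affine component -/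
theorem aux_affine (a c : ℝ) (i : Fin 2) (x : E2) :
    HasFDerivAt (fun y : E2 => a + c * y i) (c • (EuclideanSpace.proj i : E2 →L[ℝ] ℝ)) x := by
  have h : HasFDerivAt (fun y : E2 => y i) (EuclideanSpace.proj i : E2 →L[ℝ] ℝ) x :=
    (EuclideanSpace.proj i : E2 →L[ℝ] ℝ).hasFDerivAt
  exact (h.const_mul c).const_add a

theorem aux_local (θ : E2 → Fin 2 → ℝ) (x : E2) (r : ℝ)
    (hd : ∀ i, DifferentiableOn ℝ (fun x => θ x i) (Metric.ball x r))
    (h : ∀ y ∈ Metric.ball x r, symCurl θ y = 0) (p : E2) (hp : p ∈ Metric.ball x r) :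
    pd 0 (fun y => θ y 0) p = pd 0 (fun y => θ y 0) x := by
  have hr : 0 < r := lt_of_le_of_lt dist_nonneg (Metric.mem_ball.1 hp)
  have hx : x ∈ Metric.ball x r := Metric.mem_ball_self hr
  simp only [aux_symCurl] at h
  set q : E2 := x + (p 0 - x 0) • EuclideanSpace.single 0 (1 : ℝ) with hqdef
  have hpq : p = q + (p 1 - x 1) • EuclideanSpace.single 1 (1 : ℝ) := by
    ext i
    fin_cases i <;> simp [hqdef]
  have hq : q ∈ Metric.ball x r := by
    rw [Metric.mem_ball] at hp ⊢
    refine lt_of_le_of_lt ?_ hp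
    rw [EuclideanSpace.dist_eq, EuclideanSpace.dist_eq]
    apply Real.sqrt_le_sqrt
    simp [Fin.sum_univ_two, hqdef, Real.dist_eq]
    positivity
  have e1 := aux_translate _ _ Metric.isOpen_ball (convex_ball x r) (hd 0) 1
    (fun y hy => (h y hy).1) q hq (p 1 - x 1) (hpq ▸ hp)
  have e2 := aux_translate _ _ Metric.isOpen_ball (convex_ball x r) (hd 1) 0
    (fun y hy => (h y hy).2.1) x hx (p 0 - x 0) hq
  rw [← hpq] at e1
  rw [← hqdef] at e2
  rw [← (h x hx).2.2]
  have := (h q hq).2.2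
  unfold pd at this ⊢
  rw [e1, ← this, e2]

/-- The kernel of symcurl on a connected open set is the lowest-order
Raviart–Thomas space `RT₀`. -/
theorem statement5 (Ω : Set E2) (hconn : IsConnected Ω) (hopen : IsOpen Ω)
    (θ : E2 → Fin 2 → ℝ) (hθ : ∀ i, ContDiffOn ℝ 1 (fun x => θ x i) Ω) :
    (∀ x ∈ Ω, symCurl θ x = 0) ↔
      ∃ (a : Fin 2 → ℝ) (c : ℝ), ∀ x ∈ Ω, ∀ i, θ x i = a i + c * x i := by
  have hd : ∀ i, DifferentiableOn ℝ (fun x => θ x i) Ω :=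
    fun i => (hθ i).differentiableOn one_ne_zero
  constructor
  · intro h
    have hloc : ∀ x ∈ Ω, (pd 0 (fun y => θ y 0)) =ᶠ[nhds x]
        fun _ => pd 0 (fun y => θ y 0) x := by
      intro x hx
      obtain ⟨r, hr, hsub⟩ := Metric.isOpen_iff.1 hopen x hx
      filter_upwards [Metric.ball_mem_nhds x hr] with p hp
      exact aux_local θ x r (fun i => (hd i).mono hsub) (fun y hy => h y (hsub hy)) p hp
    obtain ⟨c, hc⟩ := hopen.exists_is_const_of_fderiv_eq_zero (𝕜 := ℝ) hconn.isPreconnected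
      (f := pd 0 (fun y => θ y 0))
      (fun x hx => ((hloc x hx).differentiableAt_iff.2
        (differentiableAt_const _)).differentiableWithinAt)
      (fun x hx => by rw [(hloc x hx).fderiv_eq]; simp)
    have hi : ∀ i, ∃ a, ∀ x ∈ Ω, θ x i - (0 + c * x i) = a := by
      intro i
      have hD : ∀ x ∈ Ω, HasFDerivAt (fun x => θ x i - (0 + c * x i)) (0 : E2 →L[ℝ] ℝ) x := by
        intro x hx
        have h1 := (((hd i) x hx).differentiableAt (hopen.mem_nhds hx)).hasFDerivAt
        have h2 := h1.sub (aux_affine 0 c i x)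
        suffices hs : fderiv ℝ (fun x => θ x i) x
            = c • (EuclideanSpace.proj i : E2 →L[ℝ] ℝ) by
          rw [hs, sub_self] at h2
          exact h2
        obtain ⟨k1, k2, k3⟩ := (aux_symCurl θ x).1 (h x hx)
        have k4 := hc x hx
        rw [k4] at k3
        unfold pd at k1 k2 k3 k4
        apply aux_ext
        intro j
        fin_cases i <;> fin_cases j <;> simp [k1, k2, k3, k4]
      exact hopen.exists_is_const_of_fderiv_eq_zero (𝕜 := ℝ) hconn.isPreconnected
        (fun x hx => (hD x hx).differentiableAt.differentiableWithinAt)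
        (fun x hx => (hD x hx).fderiv)
    choose a ha using hi
    exact ⟨a, c, fun x hx i => by have := ha i x hx; linarith⟩
  · rintro ⟨a, c, h⟩ x hx
    have hf : ∀ i, fderiv ℝ (fun y => θ y i) x
        = c • (EuclideanSpace.proj i : E2 →L[ℝ] ℝ) := by
      intro i
      rw [← (aux_affine (a i) c i x).fderiv]
      apply Filter.EventuallyEq.fderiv_eq
      filter_upwards [hopen.mem_nhds hx] with y hy using h y hy i
    rw [aux_symCurl]
    unfold pd
    simp [hf]

end
end

section
/- Let Ω ⊆ ℝ² be a convex open set and let f : Ω → ℝ be a smooth function. Then there exists a smooth matrix field B : Ω → ℝ^{2×2} such that B(x) is symmetric for every x ∈ Ω and divdiv B = f on Ω. (Exactness of the two-dimensional div-div complex at L²: surjectivity of divdiv from smooth symmetric tensor fields onto smooth functions.) -/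
open MeasureTheory

noncomputable section

lemma seg_mem {Ω : Set E2} (hconv : Convex ℝ Ω) {c x : E2} (hc : c ∈ Ω) (hx : x ∈ Ω) {t : ℝ}
    (ht : t ∈ Set.Icc (0:ℝ) 1) : c + t • (x - c) ∈ Ω :=
  hconv.add_smul_sub_mem hc hx ht

lemma seg_cont {F : Type} [NormedAddCommGroup F] [NormedSpace ℝ F] {Ω : Set E2}
    (hconv : Convex ℝ Ω) {c : E2} (hc : c ∈ Ω) (f : E2 → F) (hf : ContinuousOn f Ω) (k : ℕ) :
    ContinuousOn (fun p : E2 × ℝ => p.2 ^ k • f (c + p.2 • (p.1 - c)))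
      (Ω ×ˢ Set.Icc (0:ℝ) 1) := by
  apply ContinuousOn.smul
  · fun_prop
  · apply hf.comp
    · fun_prop
    · rintro ⟨x, t⟩ ⟨hx, ht⟩
      exact seg_mem hconv hc hx ht

lemma seg_cont1 {F : Type} [NormedAddCommGroup F] [NormedSpace ℝ F] {Ω : Set E2}
    (hconv : Convex ℝ Ω) {c x : E2} (hc : c ∈ Ω) (hx : x ∈ Ω) (f : E2 → F)
    (hf : ContinuousOn f Ω) (k : ℕ) :
    ContinuousOn (fun t : ℝ => t ^ k • f (c + t • (x - c))) (Set.Icc (0:ℝ) 1) := by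
  have := (seg_cont hconv hc f hf k).comp (f := fun t : ℝ => (x, t)) (s := Set.Icc (0:ℝ) 1)
    (by fun_prop) (fun t ht => ⟨hx, ht⟩)
  exact this

lemma seg_intble {F : Type} [NormedAddCommGroup F] [NormedSpace ℝ F] {Ω : Set E2}
    (hconv : Convex ℝ Ω) {c x : E2} (hc : c ∈ Ω) (hx : x ∈ Ω) (f : E2 → F)
    (hf : ContinuousOn f Ω) (k : ℕ) :
    IntervalIntegrable (fun t : ℝ => t ^ k • f (c + t • (x - c))) volume 0 1 := by
  apply ContinuousOn.intervalIntegrable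
  rw [Set.uIcc_of_le zero_le_one]
  exact seg_cont1 hconv hc hx f hf k

lemma key_deriv {F : Type} [NormedAddCommGroup F] [NormedSpace ℝ F] [CompleteSpace F] {Ω : Set E2}
    (hconv : Convex ℝ Ω) (hopen : IsOpen Ω) {c x : E2} (hc : c ∈ Ω) (hx : x ∈ Ω) (f : E2 → F)
    (hf : ContDiffOn ℝ (⊤ : ℕ∞) f Ω) (k : ℕ) :
    HasFDerivAt (fun x => ∫ t in (0:ℝ)..1, t ^ k • f (c + t • (x - c)))
      (∫ t in (0:ℝ)..1, t ^ (k+1) • fderiv ℝ f (c + t • (x - c))) x := by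
  have hf' : ContinuousOn (fderiv ℝ f) Ω := hf.continuousOn_fderiv_of_isOpen hopen (by simp)
  have hd : ∀ y ∈ Ω, HasFDerivAt f (fderiv ℝ f y) y := fun y hy =>
    ((hf.contDiffAt (hopen.mem_nhds hy)).differentiableAt (by simp)).hasFDerivAt
  obtain ⟨r, hr, hrΩ⟩ := Metric.nhds_basis_closedBall.mem_iff.1 (hopen.mem_nhds hx)
  obtain ⟨C, hC⟩ := ((isCompact_closedBall x r).prod
    (isCompact_Icc (a := (0:ℝ)) (b := 1))).exists_bound_of_continuousOn
    ((seg_cont hconv hc (fderiv ℝ f) hf' (k+1)).mono (Set.prod_mono hrΩ le_rfl))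
  have hsub : Set.uIoc (0:ℝ) 1 ⊆ Set.Icc 0 1 := by
    rw [Set.uIoc_of_le zero_le_one]; exact Set.Ioc_subset_Icc_self
  refine intervalIntegral.hasFDerivAt_integral_of_dominated_of_fderiv_le
    (F' := fun x t => t ^ (k+1) • fderiv ℝ f (c + t • (x - c)))
    (s := Metric.closedBall x r) (bound := fun _ => C) (Metric.closedBall_mem_nhds x hr)
    ?_ ?_ ?_ ?_ ?_ ?_
  · filter_upwards [hopen.mem_nhds hx] with y hy
    exact (intervalIntegrable_iff.1 (seg_intble hconv hc hy f hf.continuousOn k)).aestronglyMeasurable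
  · exact seg_intble hconv hc hx f hf.continuousOn k
  · exact (intervalIntegrable_iff.1 (seg_intble hconv hc hx _ hf' (k+1))).aestronglyMeasurable
  · exact Filter.Eventually.of_forall fun t ht y hy => hC (y, t) ⟨hy, hsub ht⟩
  · simp
  · refine Filter.Eventually.of_forall fun t ht y hy => ?_
    have h1 := hd _ (seg_mem hconv hc (hrΩ hy) (hsub ht))
    have h2 : HasFDerivAt (fun y : E2 => c + t • (y - c)) (t • ContinuousLinearMap.id ℝ E2) y :=
      (((hasFDerivAt_id y).sub_const c).const_smul t).const_add c
    have h3 := (h1.comp y h2).const_smul (t ^ k)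
    refine HasFDerivAt.congr_fderiv (f := fun y : E2 => t ^ k • f (c + t • (y - c))) h3 ?_
    ext v
    simp [pow_succ, smul_smul]

lemma key_smooth_nat (n : ℕ) : ∀ {F : Type} [NormedAddCommGroup F] [NormedSpace ℝ F]
    [CompleteSpace F] {Ω : Set E2}
    (_ : Convex ℝ Ω) (_ : IsOpen Ω) {c : E2} (_ : c ∈ Ω) (f : E2 → F)
    (_ : ContDiffOn ℝ (⊤ : ℕ∞) f Ω) (k : ℕ),
    ContDiffOn ℝ n (fun x => ∫ t in (0:ℝ)..1, t ^ k • f (c + t • (x - c))) Ω := by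
  induction n with
  | zero =>
    intro F _ _ _ Ω hconv hopen c hc f hf k
    rw [Nat.cast_zero, contDiffOn_zero]
    exact fun x hx => (key_deriv hconv hopen hc hx f hf k).continuousAt.continuousWithinAt
  | succ n ih =>
    intro F _ _ _ Ω hconv hopen c hc f hf k
    rw [Nat.cast_succ, contDiffOn_succ_iff_fderiv_of_isOpen hopen]
    refine ⟨fun x hx =>
      (key_deriv hconv hopen hc hx f hf k).differentiableAt.differentiableWithinAt, by simp, ?_⟩
    refine (ih hconv hopen hc (fderiv ℝ f) (hf.fderiv_of_isOpen hopen (by simp)) (k+1)).congr ?_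
    exact fun x hx => (key_deriv hconv hopen hc hx f hf k).fderiv

lemma euler_solve {Ω : Set E2} (hconv : Convex ℝ Ω) (hopen : IsOpen Ω) {c : E2} (hc : c ∈ Ω)
    (f : E2 → ℝ) (hf : ContDiffOn ℝ (⊤ : ℕ∞) f Ω) (k : ℕ) :
    ∃ g : E2 → ℝ, ContDiffOn ℝ (⊤ : ℕ∞) g Ω ∧
      ∀ x ∈ Ω, fderiv ℝ g x (x - c) + (k + 1) * g x = f x := by
  refine ⟨fun x => ∫ t in (0:ℝ)..1, t ^ k • f (c + t • (x - c)),
    contDiffOn_infty.2 fun n => key_smooth_nat n hconv hopen hc f hf k, fun x hx => ?_⟩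
  have hf' : ContinuousOn (fderiv ℝ f) Ω := hf.continuousOn_fderiv_of_isOpen hopen (by simp)
  have hd : ∀ y ∈ Ω, HasFDerivAt f (fderiv ℝ f y) y := fun y hy =>
    ((hf.contDiffAt (hopen.mem_nhds hy)).differentiableAt (by simp)).hasFDerivAt
  have i1 := seg_intble hconv hc hx _ hf' (k+1)
  have i2 : IntervalIntegrable
      (fun t : ℝ => (t ^ (k+1) • fderiv ℝ f (c + t • (x - c))) (x - c)) volume 0 1 :=
    ⟨i1.1.apply_continuousLinearMap (x - c), i1.2.apply_continuousLinearMap (x - c)⟩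
  have i0 := seg_intble hconv hc hx _ hf.continuousOn k
  rw [(key_deriv hconv hopen hc hx f hf k).fderiv, ContinuousLinearMap.intervalIntegral_apply i1,
    ← intervalIntegral.integral_const_mul, ← intervalIntegral.integral_add]
  · rw [intervalIntegral.integral_eq_sub_of_hasDerivAt
      (f := fun t : ℝ => t ^ (k+1) * f (c + t • (x - c)))]
    · simp
    · intro t ht
      rw [Set.uIcc_of_le zero_le_one] at ht
      have h1 := hd _ (seg_mem hconv hc hx ht)
      have h2 : HasDerivAt (fun t : ℝ => c + t • (x - c)) (x - c) t := by
        simpa using ((hasDerivAt_id t).smul_const (x - c)).const_add c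
      have h3 := (hasDerivAt_pow (k+1) t).mul (h1.comp_hasDerivAt t h2)
      refine HasDerivAt.congr_deriv (f := fun t : ℝ => t ^ (k+1) * f (c + t • (x - c))) h3 ?_
      simp
      ring
    · exact i2.add (i0.const_mul _)
  · exact i2
  · exact i0.const_mul _

lemma pd_mul {i : Fin 2} {f g : E2 → ℝ} {x : E2} (hf : DifferentiableAt ℝ f x)
    (hg : DifferentiableAt ℝ g x) :
    pd i (fun y => f y * g y) x = pd i f x * g x + f x * pd i g x := by
  simp only [pd]
  rw [fderiv_fun_mul hf hg]
  simp
  ring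

lemma pd_coord (i j : Fin 2) (c x : E2) :
    pd i (fun y : E2 => y j - c j) x = if j = i then 1 else 0 := by
  have h : HasFDerivAt (fun y : E2 => y j - c j) (EuclideanSpace.proj j : E2 →L[ℝ] ℝ) x :=
    ((EuclideanSpace.proj j : E2 →L[ℝ] ℝ).hasFDerivAt).sub_const (c j)
  simp [pd, h.fderiv, Pi.single_apply]

lemma coord_diff (j : Fin 2) (c x : E2) : DifferentiableAt ℝ (fun y : E2 => y j - c j) x := 
  (((EuclideanSpace.proj j : E2 →L[ℝ] ℝ).hasFDerivAt).sub_const (c j)).differentiableAt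

lemma euler_pd (g : E2 → ℝ) (c x : E2) :
    fderiv ℝ g x (x - c) = (x 0 - c 0) * pd 0 g x + (x 1 - c 1) * pd 1 g x := by
  have : x - c = (x 0 - c 0) • EuclideanSpace.single (0 : Fin 2) (1:ℝ)
      + (x 1 - c 1) • EuclideanSpace.single (1 : Fin 2) (1:ℝ) := by
    ext i; fin_cases i <;> simp
  rw [this, map_add, map_smul, map_smul]
  rfl

/-- Surjectivity of divdiv from smooth symmetric tensor fields onto smooth
functions on a convex open set. -/
theorem statement7 (Ω : Set E2) (hconv : Convex ℝ Ω) (hopen : IsOpen Ω)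
    (f : E2 → ℝ) (hf : ContDiffOn ℝ (⊤ : ℕ∞) f Ω) :
    ∃ B : E2 → Matrix (Fin 2) (Fin 2) ℝ,
      (∀ i j, ContDiffOn ℝ (⊤ : ℕ∞) (fun x => B x i j) Ω) ∧
      (∀ x ∈ Ω, (B x).IsSymm) ∧
      ∀ x ∈ Ω, divDiv B x = f x := by
  rcases Ω.eq_empty_or_nonempty with rfl | ⟨c, hc⟩
  · exact ⟨fun _ => 0, by simp, by simp, by simp⟩
  obtain ⟨h, hh, hhe⟩ := euler_solve hconv hopen hc f hf 1
  obtain ⟨g, hg, hge⟩ := euler_solve hconv hopen hc h hh 2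
  have dg : ∀ x ∈ Ω, DifferentiableAt ℝ g x := fun y hy =>
    (hg.contDiffAt (hopen.mem_nhds hy)).differentiableAt (by simp)
  have dh : ∀ x ∈ Ω, DifferentiableAt ℝ h x := fun y hy =>
    (hh.contDiffAt (hopen.mem_nhds hy)).differentiableAt (by simp)
  let B : E2 → Matrix (Fin 2) (Fin 2) ℝ := fun x =>
    Matrix.of fun i j => (x i - c i) * ((x j - c j) * g x)
  have hcs : ∀ i, ContDiffOn ℝ (⊤ : ℕ∞) (fun y : E2 => y i - c i) Ω := fun i =>
    (((EuclideanSpace.proj i : E2 →L[ℝ] ℝ).contDiff).sub contDiff_const).contDiffOn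
  have hdiv : ∀ i, ∀ x ∈ Ω, divMat B x i = (x i - c i) * h x := by
    intro i x hx
    have e := hge x hx
    rw [euler_pd] at e
    have d := coord_diff (c := c) (x := x)
    have d2 : ∀ j, DifferentiableAt ℝ (fun y : E2 => (y j - c j) * g y) x :=
      fun j => (d j).mul (dg x hx)
    simp only [divMat, B, Matrix.of_apply]
    rw [pd_mul (d i) (d2 0), pd_mul (d i) (d2 1),
      pd_mul (d 0) (dg x hx), pd_mul (d 1) (dg x hx), pd_coord, pd_coord, pd_coord, pd_coord, ← e]
    fin_cases i <;> simp <;> ring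
  refine ⟨B, fun i j => (hcs i).mul ((hcs j).mul hg), fun x _ => ?_, fun x hx => ?_⟩
  · ext i j
    simp only [B, Matrix.transpose_apply, Matrix.of_apply]
    ring
  · have hp : ∀ i, pd i (fun y => divMat B y i) x = pd i (fun y => (y i - c i) * h y) x := by
      intro i
      unfold pd
      rw [Filter.EventuallyEq.fderiv_eq]
      filter_upwards [hopen.mem_nhds hx] with y hy using hdiv i y hy
    have e := hhe x hx
    rw [euler_pd] at e
    rw [divDiv, hp, hp, pd_mul (coord_diff _ _ _) (dh x hx), pd_mul (coord_diff _ _ _) (dh x hx),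
      pd_coord, pd_coord, ← e]
    simp
    ring

end
end
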